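/- arXiv:math/0012073 — 3 statements merged into one kernel-verified Lean document; each statement's English description precedes it below -/
import Mathlib

section
/- Let H be a quasitriangular Hopf π-coalgebra over a field k with crossing φ and R-matrix R = {R_{α,β}}. Then for all α, β, γ ∈ π: (a) (ε ⊗ id_{H_α})(R_{1,α}) = 1_α = (id_{H_α} ⊗ ε)(R_{α,1}); (b) (S_{α⁻¹}φ_α ⊗ id_{H_β})(R_{α⁻¹,β}) = R_{α,β}⁻¹ and (id_{H_α} ⊗ S_β)(R_{α,β}⁻¹) = R_{α,β⁻¹}; (c) (S_α ⊗ S_β)(R_{α,β}) = (φ_α ⊗ id_{H_{β⁻¹}})(R_{α⁻¹,β⁻¹}); (d) the Yang–Baxter equation (R_{β,γ})_{α23}·(R_{α,γ})_{1β3}·(R_{α,β})_{12γ} = (R_{α,β})_{12γ}·[(id_{H_α} ⊗ φ_{β⁻¹})(R_{α,βγβ⁻¹})]_{1β3}·(R_{β,γ})_{α23} holds in H_α ⊗ H_β ⊗ H_γ. -/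
open scoped TensorProduct

noncomputable section

/-- Transport of the algebra structure along an equality of group indices. -/
def gcast (k : Type*) [CommSemiring k] {π : Type*} (H : π → Type*)
    [∀ α, Ring (H α)] [∀ α, Algebra k (H α)] {a b : π} (h : a = b) :
    H a ≃ₐ[k] H b := by subst h; exact AlgEquiv.refl

/-- Transport of a module family along an equality of group indices. -/
def fcast (k : Type*) [CommSemiring k] {π : Type*} (M : π → Type*)
    [∀ α, AddCommGroup (M α)] [∀ α, Module k (M α)] {a b : π} (h : a = b) :
    M a ≃ₗ[k] M b := by subst h; exact LinearEquiv.refl k (M a)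

/-- A Hopf `π`-coalgebra (in the sense of Turaev/Virelizier) over a field `k`:
a family of `k`-algebras `H α` with comultiplication `Δ`, counit `ε` and antipode `S`. -/
class HopfGCoalgebra (k : Type*) [Field k] {π : Type*} [Group π]
    (H : π → Type*) [∀ α, Ring (H α)] [∀ α, Algebra k (H α)] where
  Δ : ∀ α β : π, H (α * β) →ₐ[k] H α ⊗[k] H β
  ε : H (1 : π) →ₐ[k] k
  S : ∀ α : π, H α →ₗ[k] H α⁻¹
  coassoc : ∀ α β γ : π,
    (TensorProduct.assoc k (H α) (H β) (H γ)).toLinearMap ∘ₗ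
        (TensorProduct.map (Δ α β).toLinearMap (LinearMap.id : H γ →ₗ[k] H γ)) ∘ₗ
        (Δ (α * β) γ).toLinearMap
      = (TensorProduct.map (LinearMap.id : H α →ₗ[k] H α) (Δ β γ).toLinearMap) ∘ₗ
        (Δ α (β * γ)).toLinearMap ∘ₗ (gcast k H (mul_assoc α β γ)).toLinearMap
  counit_right : ∀ α : π,
    (TensorProduct.rid k (H α)).toLinearMap ∘ₗ
        (TensorProduct.map (LinearMap.id : H α →ₗ[k] H α) ε.toLinearMap) ∘ₗ
        (Δ α 1).toLinearMap ∘ₗ (gcast k H (mul_one α).symm).toLinearMap = LinearMap.id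
  counit_left : ∀ α : π,
    (TensorProduct.lid k (H α)).toLinearMap ∘ₗ
        (TensorProduct.map ε.toLinearMap (LinearMap.id : H α →ₗ[k] H α)) ∘ₗ
        (Δ 1 α).toLinearMap ∘ₗ (gcast k H (one_mul α).symm).toLinearMap = LinearMap.id
  antipode_left : ∀ α : π,
    (LinearMap.mul' k (H α)) ∘ₗ
        (TensorProduct.map ((gcast k H (inv_inv α)).toLinearMap ∘ₗ S α⁻¹)
          (LinearMap.id : H α →ₗ[k] H α)) ∘ₗ (Δ α⁻¹ α).toLinearMap
      = (Algebra.linearMap k (H α)) ∘ₗ ε.toLinearMap ∘ₗ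
        (gcast k H (inv_mul_cancel α)).toLinearMap
  antipode_right : ∀ α : π,
    (LinearMap.mul' k (H α)) ∘ₗ
        (TensorProduct.map (LinearMap.id : H α →ₗ[k] H α)
          ((gcast k H (inv_inv α)).toLinearMap ∘ₗ S α⁻¹)) ∘ₗ (Δ α α⁻¹).toLinearMap
      = (Algebra.linearMap k (H α)) ∘ₗ ε.toLinearMap ∘ₗ
        (gcast k H (mul_inv_cancel α)).toLinearMap

namespace HopfGCoalgebra

variable (k : Type*) [Field k] {π : Type*} [Group π] (H : π → Type*)
  [∀ α, Ring (H α)] [∀ α, Algebra k (H α)] [HopfGCoalgebra k H]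

/-- A left `π`-integral for `H`. -/
def IsLeftIntegral (lam : ∀ α : π, H α →ₗ[k] k) : Prop :=
  ∀ (α β : π) (x : H (α * β)),
    (TensorProduct.rid k (H α))
        (TensorProduct.map (LinearMap.id : H α →ₗ[k] H α) (lam β) (Δ α β x))
      = lam (α * β) x • (1 : H α)

/-- A right `π`-integral for `H`. -/
def IsRightIntegral (lam : ∀ α : π, H α →ₗ[k] k) : Prop :=
  ∀ (α β : π) (x : H (α * β)),
    (TensorProduct.lid k (H β))
        (TensorProduct.map (lam α) (LinearMap.id : H β →ₗ[k] H β) (Δ α β x))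
      = lam (α * β) x • (1 : H β)

/-- A `π`-grouplike element of `H`. -/
def IsGrouplike (g : ∀ α : π, H α) : Prop :=
  (∀ α β : π, Δ α β (g (α * β)) = g α ⊗ₜ[k] g β) ∧ ε (k := k) (H := H) (g 1) = 1

/-- `g` is the distinguished `π`-grouplike element of `H`. -/
def IsDistinguishedGrouplike (g : ∀ α : π, H α) : Prop :=
  IsGrouplike k H g ∧
    ∀ lam : ∀ α : π, H α →ₗ[k] k, IsRightIntegral k H lam →
      ∀ (α β : π) (x : H (α * β)),
        (TensorProduct.rid k (H α))
            (TensorProduct.map (LinearMap.id : H α →ₗ[k] H α) (lam β) (Δ α β x))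
          = lam (α * β) x • g α

/-- `ν` is the distinguished grouplike element of `H₁*`. -/
def IsDistinguishedNu (ν : H (1 : π) →ₐ[k] k) : Prop :=
  ∀ Λ : H (1 : π), (∀ x : H (1 : π), x * Λ = ε (k := k) (H := H) x • Λ) →
    ∀ x : H (1 : π), Λ * x = ν x • Λ

/-- The right action `a ↼ f` of `f ∈ H₁*` on `a ∈ H α`. -/
def hitR (f : H (1 : π) →ₗ[k] k) {α : π} (a : H α) : H α :=
  (TensorProduct.lid k (H α))
    (TensorProduct.map f (LinearMap.id : H α →ₗ[k] H α)
      (Δ 1 α ((gcast k H (one_mul α).symm) a)))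

/-- The left action `f ⇀ a` of `f ∈ H₁*` on `a ∈ H α`. -/
def hitL (f : H (1 : π) →ₗ[k] k) {α : π} (a : H α) : H α :=
  (TensorProduct.rid k (H α))
    (TensorProduct.map (LinearMap.id : H α →ₗ[k] H α) f
      (Δ α 1 ((gcast k H (mul_one α).symm) a)))


/-- The comultiplication, with all arguments explicit. -/
def comul (α β : π) : H (α * β) →ₐ[k] H α ⊗[k] H β := Δ α β

/-- The counit, with all arguments explicit. -/
def counit : H (1 : π) →ₐ[k] k := ε

/-- The antipode, with all arguments explicit. -/
def antipode (α : π) : H α →ₗ[k] H α⁻¹ := S α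

end HopfGCoalgebra

open HopfGCoalgebra
/-- A right Hopf `π`-comodule over `H`. -/
class HopfGComodule (k : Type*) [Field k] {π : Type*} [Group π]
    (H : π → Type*) [∀ α, Ring (H α)] [∀ α, Algebra k (H α)] [HopfGCoalgebra k H]
    (M : π → Type*) [∀ α, AddCommGroup (M α)] [∀ α, Module k (M α)] where
  ρ : ∀ α β : π, M (α * β) →ₗ[k] M α ⊗[k] H β
  ρ_coassoc : ∀ α β γ : π,
    (TensorProduct.assoc k (M α) (H β) (H γ)).toLinearMap ∘ₗ
        (TensorProduct.map (ρ α β) (LinearMap.id : H γ →ₗ[k] H γ)) ∘ₗ (ρ (α * β) γ)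
      = (TensorProduct.map (LinearMap.id : M α →ₗ[k] M α) (Δ β γ).toLinearMap) ∘ₗ
        (ρ α (β * γ)) ∘ₗ (fcast k M (mul_assoc α β γ)).toLinearMap
  ρ_counit : ∀ α : π,
    (TensorProduct.rid k (M α)).toLinearMap ∘ₗ
        (TensorProduct.map (LinearMap.id : M α →ₗ[k] M α)
          (ε (k := k) (H := H)).toLinearMap) ∘ₗ
        (ρ α 1) ∘ₗ (fcast k M (mul_one α).symm).toLinearMap = LinearMap.id
  act : ∀ α : π, M α →ₗ[k] H α →ₗ[k] M α
  act_one : ∀ (α : π) (m : M α), act α m 1 = m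
  act_mul : ∀ (α : π) (m : M α) (a b : H α), act α (act α m a) b = act α m (a * b)
  ρ_act : ∀ (α β : π) (m : M (α * β)) (a : H (α * β)),
    ρ α β (act (α * β) m a)
      = TensorProduct.map (TensorProduct.lift (act α)) (LinearMap.mul' k (H β))
          ((TensorProduct.tensorTensorTensorComm k (M α) (H β) (H α) (H β))
            (ρ α β m ⊗ₜ[k] (Δ α β a)))

namespace HopfGComodule

variable (k : Type*) [Field k] {π : Type*} [Group π] (H : π → Type*)
  [∀ α, Ring (H α)] [∀ α, Algebra k (H α)] [HopfGCoalgebra k H]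
  (M : π → Type*) [∀ α, AddCommGroup (M α)] [∀ α, Module k (M α)] [HopfGComodule k H M]

/-- The submodule of coinvariant families of `H` on `M`. -/
def coinvFam : Submodule k (∀ α, M α) where
  carrier := {m | ∀ α β : π, ρ (H := H) α β (m (α * β)) = m α ⊗ₜ[k] (1 : H β)}
  add_mem' := by
    intro a b ha hb α β
    simp only [Pi.add_apply, map_add, ha α β, hb α β, TensorProduct.add_tmul]
  zero_mem' := by
    intro α β
    simp only [Pi.zero_apply, map_zero, TensorProduct.zero_tmul]
  smul_mem' := by
    intro c a ha α β
    simp only [Pi.smul_apply, map_smul, ha α β, TensorProduct.smul_tmul']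

/-- The `α`-component of the `π`-subcomodule of coinvariants. -/
def coinvSub (α : π) : Submodule k (M α) :=
  (coinvFam k H M).map (LinearMap.proj α : (∀ γ, M γ) →ₗ[k] M α)


/-- The comodule structure maps, with all arguments explicit. -/
def coact (α β : π) : M (α * β) →ₗ[k] M α ⊗[k] H β := ρ α β

/-- The right `H α`-action on `M α`, with all arguments explicit. -/
def hact (α : π) : M α →ₗ[k] H α →ₗ[k] M α := act α

end HopfGComodule

section Cosemisimple

variable (k : Type*) [Field k] {π : Type*} [Group π] (H : π → Type*)
  [∀ α, Ring (H α)] [∀ α, Algebra k (H α)]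
  (M : π → Type*) [∀ α, AddCommGroup (M α)] [∀ α, Module k (M α)]

/-- `N` is a `π`-subcomodule of the right `π`-comodule `(M, ρ)` over `H`. -/
def IsGSubcomodule (ρ : ∀ α β : π, M (α * β) →ₗ[k] M α ⊗[k] H β)
    (N : ∀ α, Submodule k (M α)) : Prop :=
  ∀ (α β : π), ∀ x ∈ N (α * β),
    ρ α β x ∈ LinearMap.range
      (TensorProduct.map (N α).subtype (LinearMap.id : H β →ₗ[k] H β))

/-- `N` is a simple `π`-subcomodule of `(M, ρ)`. -/
def IsSimpleGSubcomodule (ρ : ∀ α β : π, M (α * β) →ₗ[k] M α ⊗[k] H β)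
    (N : ∀ α, Submodule k (M α)) : Prop :=
  IsGSubcomodule k H M ρ N ∧ (∃ α, N α ≠ ⊥) ∧
    ∀ P : ∀ α, Submodule k (M α), IsGSubcomodule k H M ρ P → (∀ α, P α ≤ N α) →
      (∀ α, P α = ⊥) ∨ P = N

/-- The right `π`-comodule `(M, ρ)` is cosemisimple: it is the sum of its simple
`π`-subcomodules. -/
def IsGCosemisimple (ρ : ∀ α β : π, M (α * β) →ₗ[k] M α ⊗[k] H β) : Prop :=
  ∀ α : π,
    (⨆ N : {N : ∀ γ, Submodule k (M γ) // IsSimpleGSubcomodule k H M ρ N}, N.1 α) = ⊤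

end Cosemisimple

section CoalgCosemisimple

variable (k : Type*) [Field k] (C : Type*) [AddCommGroup C] [Module k C]

/-- `N` is a subcomodule of the coalgebra `(C, δ)` viewed as a right comodule over itself. -/
def IsSubcoideal (δ : C →ₗ[k] C ⊗[k] C) (N : Submodule k C) : Prop :=
  ∀ x ∈ N, δ x ∈ LinearMap.range (TensorProduct.map N.subtype (LinearMap.id : C →ₗ[k] C))

def IsSimpleSubcoideal (δ : C →ₗ[k] C ⊗[k] C) (N : Submodule k C) : Prop :=
  IsSubcoideal k C δ N ∧ N ≠ ⊥ ∧
    ∀ P : Submodule k C, IsSubcoideal k C δ P → P ≤ N → P = ⊥ ∨ P = N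

/-- The coalgebra `(C, δ)` is cosemisimple. -/
def IsCosemisimpleCoalgebra (δ : C →ₗ[k] C ⊗[k] C) : Prop :=
  (⨆ N : {N : Submodule k C // IsSimpleSubcoideal k C δ N}, N.1) = ⊤

end CoalgCosemisimple
/-- A crossed Hopf `π`-coalgebra: a Hopf `π`-coalgebra with a crossing `φ`. -/
class CrossedHopfGCoalgebra (k : Type*) [Field k] {π : Type*} [Group π]
    (H : π → Type*) [∀ α, Ring (H α)] [∀ α, Algebra k (H α)]
    extends HopfGCoalgebra k H where
  φ : ∀ β α : π, H α ≃ₐ[k] H (β * α * β⁻¹)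
  φ_comul : ∀ β α γ : π,
    (TensorProduct.map (φ β α).toLinearMap (φ β γ).toLinearMap) ∘ₗ (Δ α γ).toLinearMap
      = (Δ (β * α * β⁻¹) (β * γ * β⁻¹)).toLinearMap ∘ₗ
        (gcast k H (show β * (α * γ) * β⁻¹ = (β * α * β⁻¹) * (β * γ * β⁻¹) by
          group)).toLinearMap ∘ₗ (φ β (α * γ)).toLinearMap
  φ_counit : ∀ (β : π) (x : H (1 : π)),
    ε ((gcast k H (show β * 1 * β⁻¹ = (1 : π) by group)) (φ β 1 x)) = ε x
  φ_mul : ∀ (β β' α : π) (x : H α),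
    (gcast k H (show β * (β' * α * β'⁻¹) * β⁻¹ = (β * β') * α * (β * β')⁻¹ by group))
        (φ β (β' * α * β'⁻¹) (φ β' α x))
      = φ (β * β') α x


namespace CrossedHopfGCoalgebra

variable (k : Type*) [Field k] {π : Type*} [Group π] (H : π → Type*)
  [∀ α, Ring (H α)] [∀ α, Algebra k (H α)] [CrossedHopfGCoalgebra k H]

/-- The crossing, with all arguments explicit. -/
def crossing (β α : π) : H α ≃ₐ[k] H (β * α * β⁻¹) := φ β α

end CrossedHopfGCoalgebra

open CrossedHopfGCoalgebra

/-- A quasitriangular Hopf `π`-coalgebra: a crossed Hopf `π`-coalgebra with an R-matrix. -/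
class QTHopfGCoalgebra (k : Type*) [Field k] {π : Type*} [Group π]
    (H : π → Type*) [∀ α, Ring (H α)] [∀ α, Algebra k (H α)]
    extends CrossedHopfGCoalgebra k H where
  Rm : ∀ α β : π, H α ⊗[k] H β
  Rm_isUnit : ∀ α β : π, IsUnit (Rm α β)
  Rm_comul : ∀ (α β : π) (x : H (α * β)),
    Rm α β * Δ α β x
      = (TensorProduct.comm k (H β) (H α))
          ((TensorProduct.map
              ((gcast k H (show α⁻¹ * (α * β * α⁻¹) * α⁻¹⁻¹ = β by group)).toLinearMap ∘ₗ
                (φ α⁻¹ (α * β * α⁻¹)).toLinearMap)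
              (LinearMap.id : H α →ₗ[k] H α))
            ((Δ (α * β * α⁻¹) α)
              ((gcast k H (show α * β = (α * β * α⁻¹) * α by group)) x))) * Rm α β
  Rm_delta_right : ∀ α β γ : π,
    TensorProduct.map (LinearMap.id : H α →ₗ[k] H α) (Δ β γ).toLinearMap (Rm α (β * γ))
      = (TensorProduct.map (LinearMap.id : H α →ₗ[k] H α)
            (TensorProduct.mk k (H β) (H γ) 1) (Rm α γ))
        * (TensorProduct.map (LinearMap.id : H α →ₗ[k] H α)
            ((TensorProduct.mk k (H β) (H γ)).flip 1) (Rm α β))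
  Rm_delta_left : ∀ α β γ : π,
    (TensorProduct.assoc k (H α) (H β) (H γ))
        (TensorProduct.map (Δ α β).toLinearMap (LinearMap.id : H γ →ₗ[k] H γ)
          (Rm (α * β) γ))
      = (TensorProduct.map (LinearMap.id : H α →ₗ[k] H α)
            (TensorProduct.mk k (H β) (H γ) 1)
            (TensorProduct.map (LinearMap.id : H α →ₗ[k] H α)
              ((gcast k H (show β⁻¹ * (β * γ * β⁻¹) * β⁻¹⁻¹ = γ by group)).toLinearMap ∘ₗ
                (φ β⁻¹ (β * γ * β⁻¹)).toLinearMap)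
              (Rm α (β * γ * β⁻¹))))
        * (TensorProduct.mk k (H α) (H β ⊗[k] H γ) 1 (Rm β γ))
  Rm_phi : ∀ β α γ : π,
    TensorProduct.map (φ β α).toLinearMap (φ β γ).toLinearMap (Rm α γ)
      = Rm (β * α * β⁻¹) (β * γ * β⁻¹)

namespace QTHopfGCoalgebra

variable (k : Type*) [Field k] {π : Type*} [Group π] (H : π → Type*)
  [∀ α, Ring (H α)] [∀ α, Algebra k (H α)] [QTHopfGCoalgebra k H]

/-- The square of the antipode `S_{α⁻¹} ∘ S_α : H α → H α`. -/
def antipodeSq (α : π) : H α →ₗ[k] H α :=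
  (gcast k H (inv_inv α)).toLinearMap ∘ₗ S α⁻¹ ∘ₗ S α

/-- The map `S_{α⁻¹} ∘ φ_α : H (α⁻¹) → H α`. -/
def sphi (α : π) : H α⁻¹ →ₗ[k] H α :=
  (gcast k H (inv_inv α)).toLinearMap ∘ₗ S α⁻¹ ∘ₗ
    (gcast k H (show α * α⁻¹ * α⁻¹ = α⁻¹ by group)).toLinearMap ∘ₗ
    (φ α α⁻¹).toLinearMap

/-- The Drinfeld element `u_α = m_α ∘ (S_{α⁻¹}φ_α ⊗ id) ∘ σ_{α,α⁻¹} (R_{α,α⁻¹})`. -/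
def drinfeld (α : π) : H α :=
  LinearMap.mul' k (H α)
    (TensorProduct.map (sphi k H α) (LinearMap.id : H α →ₗ[k] H α)
      ((TensorProduct.comm k (H α) (H α⁻¹)) (Rm α α⁻¹)))

/-- The element `S_{α⁻¹}(u_{α⁻¹}) ∈ H α`. -/
def sdrinfeld (α : π) : H α :=
  (gcast k H (inv_inv α)) (S (k := k) (H := H) α⁻¹ (drinfeld k H α⁻¹))

/-- The `π`-grouplike element `ℓ_α = S_{α⁻¹}(u_{α⁻¹})⁻¹ u_α`. -/
def ell (α : π) : H α :=
  Ring.inverse (sdrinfeld k H α) * drinfeld k H α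


/-- The R-matrix, with all arguments explicit. -/
def rmatrix (α β : π) : H α ⊗[k] H β := Rm α β

end QTHopfGCoalgebra

open QTHopfGCoalgebra

open Algebra.TensorProduct (includeLeft includeRight)

namespace QTHopfGCoalgebra

section Transport

variable {k : Type*} [Field k] {π : Type*} {H : π → Type*}
  [∀ α, Ring (H α)] [∀ α, Algebra k (H α)]

@[simp]
theorem gcast_rfl_apply {a : π} (h : a = a) (x : H a) : gcast k H h x = x := rfl

theorem gcast_gcast {a b c : π} (h : a = b) (h' : b = c) (x : H a) :
    gcast k H h' (gcast k H h x) = gcast k H (h.trans h') x := by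
  subst h h'
  rfl

end Transport

section Flexible

variable (k : Type*) [Field k] {π : Type*} [Group π] (H : π → Type*)
  [∀ α, Ring (H α)] [∀ α, Algebra k (H α)]

/-- The comultiplication on `H c`, for any index `c` equal to `a * b`. -/
def comulOfEq [HopfGCoalgebra k H] {a b c : π} (h : c = a * b) : H c →ₐ[k] H a ⊗[k] H b :=
  (Δ a b).comp (gcast k H h).toAlgHom

/-- The antipode `H a → H b`, for any index `b` equal to `a⁻¹`. -/
def antipodeOfEq [HopfGCoalgebra k H] {a b : π} (h : b = a⁻¹) : H a →ₗ[k] H b :=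
  (gcast k H h.symm).toLinearMap ∘ₗ S a

/-- The crossing `φ_β : H a → H b`, for any index `b` equal to `β * a * β⁻¹`. -/
def crossingOfEq [CrossedHopfGCoalgebra k H] (β : π) {a b : π} (h : b = β * a * β⁻¹) :
    H a ≃ₐ[k] H b :=
  (φ β a).trans (gcast k H h.symm)

end Flexible

section Hopf

variable {k : Type*} [Field k] {π : Type*} [Group π] {H : π → Type*}
  [∀ α, Ring (H α)] [∀ α, Algebra k (H α)] [HopfGCoalgebra k H]

theorem counit_left_apply {a : π} (h : a = 1 * a) (x : H a) :
    TensorProduct.lid k (H a) (TensorProduct.map (counit k H).toLinearMap LinearMap.id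
      (comulOfEq k H h x)) = x :=
  LinearMap.congr_fun (counit_left (k := k) (H := H) a) x

theorem antipode_left_apply {a b : π} (h : b = a⁻¹) (h' : 1 = a * b) (x : H (1 : π)) :
    LinearMap.mul' k (H b) (TensorProduct.map (antipodeOfEq k H h) LinearMap.id
      (comulOfEq k H h' x)) = algebraMap k (H b) (counit k H x) := by
  obtain rfl : a = b⁻¹ := by rw [h, inv_inv]
  have := LinearMap.congr_fun (antipode_left (k := k) (H := H) b) (gcast k H h' x)
  simp only [LinearMap.comp_apply, AlgEquiv.toLinearMap_apply, gcast_gcast] at this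
  exact this

end Hopf

section Crossed

variable {k : Type*} [Field k] {π : Type*} [Group π] {H : π → Type*}
  [∀ α, Ring (H α)] [∀ α, Algebra k (H α)] [CrossedHopfGCoalgebra k H]

theorem crossingOfEq_crossingOfEq {β β' δ a b c : π} (h : b = β' * a * β'⁻¹)
    (h' : c = β * b * β⁻¹) (hδ : δ = β * β') (h'' : c = δ * a * δ⁻¹) (x : H a) :
    crossingOfEq k H β h' (crossingOfEq k H β' h x) = crossingOfEq k H δ h'' x := by
  subst hδ h
  have := φ_mul (k := k) (H := H) β β' a x
  simp only [crossingOfEq, AlgEquiv.trans_apply, ← this, gcast_gcast, gcast_rfl_apply]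

theorem crossingOfEq_one {a : π} (h : a = 1 * a * 1⁻¹) (x : H a) :
    crossingOfEq k H 1 h x = x :=
  (crossingOfEq k H 1 h).injective
    (crossingOfEq_crossingOfEq h h (one_mul 1).symm h x)

theorem crossingOfEq_inv_crossingOfEq {β β' a b : π} (h : b = β * a * β⁻¹)
    (h' : a = β' * b * β'⁻¹) (hβ : β' * β = 1) (x : H a) :
    crossingOfEq k H β' h' (crossingOfEq k H β h x) = x := by
  rw [crossingOfEq_crossingOfEq h h' hβ.symm (by group), crossingOfEq_one]

end Crossed

section Quasitriangular

variable {k : Type*} [Field k] {π : Type*} [Group π] {H : π → Type*}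
  [∀ α, Ring (H α)] [∀ α, Algebra k (H α)] [QTHopfGCoalgebra k H]

theorem isUnit_rmatrix (a b : π) : IsUnit (rmatrix k H a b) := Rm_isUnit a b

theorem map_crossingOfEq_rmatrix {β a b a' b' : π} (ha : a' = β * a * β⁻¹)
    (hb : b' = β * b * β⁻¹) :
    Algebra.TensorProduct.map (crossingOfEq k H β ha).toAlgHom (crossingOfEq k H β hb).toAlgHom
      (rmatrix k H a b) = rmatrix k H a' b' := by
  subst ha hb
  exact Rm_phi β a b

theorem map_comulOfEq_rmatrix_right {a b c g : π} (h : c = b * g) :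
    Algebra.TensorProduct.map (AlgHom.id k (H a)) (comulOfEq k H h) (rmatrix k H a c) =
      Algebra.TensorProduct.map (AlgHom.id k (H a)) includeRight (rmatrix k H a g) *
      Algebra.TensorProduct.map (AlgHom.id k (H a)) includeLeft (rmatrix k H a b) := by
  subst h
  exact Rm_delta_right a b g

theorem map_comulOfEq_rmatrix_left {a b c g g' : π} (h : c = a * b) (hg : g' = b * g * b⁻¹)
    (hg' : g = b⁻¹ * g' * b⁻¹⁻¹) :
    TensorProduct.assoc k (H a) (H b) (H g)
      (TensorProduct.map (comulOfEq k H h).toLinearMap LinearMap.id (rmatrix k H c g)) =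
      Algebra.TensorProduct.map (AlgHom.id k (H a)) includeRight
        (Algebra.TensorProduct.map (AlgHom.id k (H a)) (crossingOfEq k H b⁻¹ hg').toAlgHom
          (rmatrix k H a g')) *
      (includeRight : H b ⊗[k] H g →ₐ[k] H a ⊗[k] (H b ⊗[k] H g)) (rmatrix k H b g) := by
  subst h hg
  exact Rm_delta_left a b g

/-- `R · Δ = Δ^{op} · R`, with the twist by the crossing packaged as algebra maps. -/
theorem rmatrix_mul_comul {a b a' : π} (ha : a' = a * b * a⁻¹)
    (hb : b = a⁻¹ * a' * a⁻¹⁻¹) (h : a * b = a' * a) (x : H (a * b)) :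
    rmatrix k H a b * comulOfEq k H rfl x =
      Algebra.TensorProduct.comm k (H b) (H a)
        (Algebra.TensorProduct.map (crossingOfEq k H a⁻¹ hb).toAlgHom (AlgHom.id k (H a))
          (comulOfEq k H h x)) * rmatrix k H a b := by
  subst ha
  exact Rm_comul a b x

/-- Moving the crossing from one tensor factor of `R` to the other. -/
theorem map_id_crossingOfEq_rmatrix {β β' a a' b b' : π} (hβ : β * β' = 1)
    (hb : b = β' * b' * β'⁻¹) (ha : a = β * a' * β⁻¹) :
    Algebra.TensorProduct.map (AlgHom.id k (H a)) (crossingOfEq k H β' hb).toAlgHom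
        (rmatrix k H a b') =
      Algebra.TensorProduct.map (crossingOfEq k H β ha).toAlgHom (AlgHom.id k (H b))
        (rmatrix k H a' b) := by
  obtain rfl : β' = β⁻¹ := (inv_eq_of_mul_eq_one_right hβ).symm
  rw [← map_crossingOfEq_rmatrix (k := k) (H := H) (β := β⁻¹) (a := a) (a' := a')
    (by rw [ha]; group) hb, ← AlgHom.comp_apply, ← Algebra.TensorProduct.map_comp]
  congr 2
  ext x
  exact (crossingOfEq_inv_crossingOfEq (by rw [ha]; group) ha (mul_inv_cancel β) x).symm

theorem counit_rmatrix_left (a : π) :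
    TensorProduct.lid k (H a) (TensorProduct.map (counit k H).toLinearMap LinearMap.id
      (rmatrix k H 1 a)) = 1 := by
  let E : H (1 : π) ⊗[k] (H (1 : π) ⊗[k] H a) →ₐ[k] H (1 : π) ⊗[k] H a :=
    (Algebra.TensorProduct.lid k (H 1 ⊗[k] H a)).toAlgHom.comp
      (Algebra.TensorProduct.map (counit k H) (AlgHom.id k (H 1 ⊗[k] H a)))
  have hl (t : H (1 : π) ⊗[k] H a) : E (TensorProduct.assoc k _ _ _ (TensorProduct.map
      (comulOfEq k H (mul_one (1 : π)).symm).toLinearMap LinearMap.id t)) = t := by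
    induction t with
    | zero => simp only [map_zero]
    | add x y hx hy => simp only [map_add, hx, hy]
    | tmul x y =>
      have := congrArg (· ⊗ₜ[k] y) (counit_left_apply (k := k) (mul_one (1 : π)).symm x)
      refine Eq.trans ?_ this
      rw [TensorProduct.map_tmul, AlgHom.toLinearMap_apply]
      generalize comulOfEq k H (mul_one (1 : π)).symm x = d
      induction d with
      | zero => simp
      | add x y hx hy => simp_all [TensorProduct.add_tmul]
      | tmul u v => simp [E, TensorProduct.smul_tmul']
  have hr (t : H (1 : π) ⊗[k] H a) :
      E (Algebra.TensorProduct.map (AlgHom.id k (H 1)) includeRight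
        (Algebra.TensorProduct.map (crossingOfEq k H 1 (by group)).toAlgHom
          (AlgHom.id k (H a)) t)) =
      includeRight (TensorProduct.lid k (H a)
        (TensorProduct.map (counit k H).toLinearMap LinearMap.id t)) := by
    induction t with
    | zero => simp only [map_zero]
    | add x y hx hy => simp only [map_add, hx, hy]
    | tmul x y => simp [E, crossingOfEq_one]
  have hr' (t : H (1 : π) ⊗[k] H a) : E (includeRight t) = t := by simp [E]
  have key := congrArg E (map_comulOfEq_rmatrix_left (k := k) (H := H)
    (a := 1) (b := 1) (c := 1) (g := a) (g' := a) (by group) (by group) (by group))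
  rw [map_id_crossingOfEq_rmatrix (mul_inv_cancel 1) _ (a' := 1) (by group), map_mul,
    hl, hr, hr'] at key
  have := (isUnit_rmatrix 1 a).mul_right_cancel (key.symm.trans (one_mul _).symm)
  have e := congrArg (Algebra.TensorProduct.lid k (H a) ∘
    Algebra.TensorProduct.map (counit k H) (AlgHom.id k (H a))) this
  simpa using e

/-- `m_b (S_a ⊗ id) Δ_{a,b}` applied to the first leg of `R_{1,g}`. -/
theorem antipode_rmatrix_mul_rmatrix {a b g g' : π} (h : b = a⁻¹) (hg' : g = b⁻¹ * g' * b⁻¹⁻¹) :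
    TensorProduct.map (antipodeOfEq k H h) (crossingOfEq k H b⁻¹ hg').toLinearMap
      (rmatrix k H a g') * rmatrix k H b g = 1 := by
  have h' : 1 = a * b := by rw [h]; group
  let M : H a ⊗[k] (H b ⊗[k] H g) →ₗ[k] H b ⊗[k] H g :=
    LinearMap.mul' k _ ∘ₗ TensorProduct.map
      ((includeLeft : H b →ₐ[k] H b ⊗[k] H g).toLinearMap ∘ₗ antipodeOfEq k H h) LinearMap.id
  have hl (t : H (1 : π) ⊗[k] H g) : M (TensorProduct.assoc k _ _ _
        (TensorProduct.map (comulOfEq k H h').toLinearMap LinearMap.id t)) =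
      includeRight (TensorProduct.lid k (H g)
        (TensorProduct.map (counit k H).toLinearMap LinearMap.id t)) := by
    induction t with
    | zero => simp only [map_zero]
    | add x y hx hy => simp only [map_add, hx, hy]
    | tmul x y =>
      have := congrArg (· ⊗ₜ[k] y) (antipode_left_apply (k := k) h h' x)
      simp only [TensorProduct.map_tmul, LinearMap.id_apply, TensorProduct.lid_tmul,
        AlgHom.toLinearMap_apply, map_smul, Algebra.TensorProduct.includeRight_apply]
      rw [TensorProduct.smul_tmul', ← Algebra.algebraMap_eq_smul_one, ← this]
      generalize comulOfEq k H h' x = d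
      induction d with
      | zero => simp
      | add x y hx hy => simp_all [TensorProduct.add_tmul]
      | tmul u v => simp [M]
  have hr (r : H a ⊗[k] H g') (s : H b ⊗[k] H g) :
      M (Algebra.TensorProduct.map (AlgHom.id k (H a)) includeRight
        (Algebra.TensorProduct.map (AlgHom.id k (H a)) (crossingOfEq k H b⁻¹ hg').toAlgHom r) *
        (includeRight : H b ⊗[k] H g →ₐ[k] H a ⊗[k] (H b ⊗[k] H g)) s) =
      TensorProduct.map (antipodeOfEq k H h) (crossingOfEq k H b⁻¹ hg').toLinearMap r * s := by
    induction r with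
    | zero => simp only [map_zero, zero_mul]
    | add x y hx hy => simp only [map_add, add_mul, hx, hy]
    | tmul x y => simp [M, ← mul_assoc]
  have key := congrArg M (map_comulOfEq_rmatrix_left (k := k) (H := H) h'
    (by rw [hg']; group) hg')
  rw [hl, hr, counit_rmatrix_left, map_one] at key
  exact key.symm

theorem counit_rmatrix_right (a : π) :
    TensorProduct.rid k (H a) (TensorProduct.map LinearMap.id (counit k H).toLinearMap
      (rmatrix k H a 1)) = 1 := by
  let E : H a ⊗[k] (H (1 : π) ⊗[k] H (1 : π)) →ₐ[k] H a ⊗[k] H (1 : π) :=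
    Algebra.TensorProduct.map (AlgHom.id k (H a))
      ((Algebra.TensorProduct.lid k (H 1)).toAlgHom.comp
        (Algebra.TensorProduct.map (counit k H) (AlgHom.id k (H 1))))
  have hl (t : H a ⊗[k] H (1 : π)) : E (Algebra.TensorProduct.map (AlgHom.id k (H a))
      (comulOfEq k H (mul_one (1 : π)).symm) t) = t := by
    induction t with
    | zero => simp only [map_zero]
    | add x y hx hy => simp only [map_add, hx, hy]
    | tmul x y => exact congrArg (x ⊗ₜ[k] ·) (counit_left_apply _ y)
  have hr (t : H a ⊗[k] H (1 : π)) :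
      E (Algebra.TensorProduct.map (AlgHom.id k (H a)) includeRight t) = t := by
    induction t with
    | zero => simp only [map_zero]
    | add x y hx hy => simp only [map_add, hx, hy]
    | tmul x y => simp [E]
  have hr' (t : H a ⊗[k] H (1 : π)) :
      E (Algebra.TensorProduct.map (AlgHom.id k (H a)) includeLeft t) =
      (includeLeft : H a →ₐ[k] H a ⊗[k] H (1 : π)) (TensorProduct.rid k (H a)
        (TensorProduct.map LinearMap.id (counit k H).toLinearMap t)) := by
    induction t with
    | zero => simp only [map_zero]
    | add x y hx hy => simp only [map_add, hx, hy]
    | tmul x y => simp [E, TensorProduct.tmul_smul, TensorProduct.smul_tmul']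
  have key := congrArg E (map_comulOfEq_rmatrix_right (k := k) (H := H) (a := a)
    (mul_one (1 : π)).symm)
  rw [hl, map_mul, hr, hr'] at key
  have := (isUnit_rmatrix a 1).mul_left_cancel (key.symm.trans (mul_one _).symm)
  have e := congrArg (Algebra.TensorProduct.rid k k (H a) ∘
    Algebra.TensorProduct.map (AlgHom.id k (H a)) (counit k H)) this
  simpa using e

theorem map_antipode_inverse_rmatrix {a b b' : π} (h : b' = b⁻¹) :
    TensorProduct.map LinearMap.id (antipodeOfEq k H h) (Ring.inverse (rmatrix k H a b)) =
      rmatrix k H a b' := by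
  have h' : 1 = b * b' := by rw [h]; group
  let N : H a ⊗[k] (H b ⊗[k] H b') →ₗ[k] H a ⊗[k] H b' :=
    TensorProduct.map LinearMap.id
      (LinearMap.mul' k _ ∘ₗ TensorProduct.map (antipodeOfEq k H h) LinearMap.id)
  have hl (t : H a ⊗[k] H (1 : π)) :
      N (Algebra.TensorProduct.map (AlgHom.id k (H a)) (comulOfEq k H h') t) =
      (includeLeft : H a →ₐ[k] H a ⊗[k] H b') (Algebra.TensorProduct.rid k k (H a)
        (Algebra.TensorProduct.map (AlgHom.id k (H a)) (counit k H) t)) := by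
    induction t with
    | zero => simp only [map_zero]
    | add x y hx hy => simp only [map_add, hx, hy]
    | tmul x y =>
      refine (congrArg (x ⊗ₜ[k] ·) (antipode_left_apply (k := k) h h' y)).trans ?_
      simp [Algebra.algebraMap_eq_smul_one, TensorProduct.smul_tmul']
  have hr (r : H a ⊗[k] H b) (s : H a ⊗[k] H b') :
      N (Algebra.TensorProduct.map (AlgHom.id k (H a)) includeLeft r *
        Algebra.TensorProduct.map (AlgHom.id k (H a)) includeRight s) =
      TensorProduct.map LinearMap.id (antipodeOfEq k H h) r * s := by
    induction r with
    | zero => simp only [map_zero, zero_mul]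
    | add x y hx hy => simp only [map_add, add_mul, hx, hy]
    | tmul x y =>
      induction s with
      | zero => simp only [map_zero, mul_zero]
      | add x y hx hy => simp only [map_add, mul_add, hx, hy]
      | tmul z w => simp [N]
  have hinv : Algebra.TensorProduct.map (AlgHom.id k (H a)) (comulOfEq k H h')
        (Ring.inverse (rmatrix k H a 1)) =
      Algebra.TensorProduct.map (AlgHom.id k (H a)) includeLeft
        (Ring.inverse (rmatrix k H a b)) *
      Algebra.TensorProduct.map (AlgHom.id k (H a)) includeRight
        (Ring.inverse (rmatrix k H a b')) := by
    refine left_inv_eq_right_inv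
      (a := Algebra.TensorProduct.map (AlgHom.id k (H a)) (comulOfEq k H h')
        (rmatrix k H a 1)) ?_ ?_
    · rw [← map_mul, Ring.inverse_mul_cancel _ (isUnit_rmatrix a 1), map_one]
    · rw [map_comulOfEq_rmatrix_right, mul_assoc, ← mul_assoc (Algebra.TensorProduct.map _
        includeLeft (rmatrix k H a b)), ← map_mul, Ring.mul_inverse_cancel _ (isUnit_rmatrix a b),
        map_one, one_mul, ← map_mul, Ring.mul_inverse_cancel _ (isUnit_rmatrix a b'), map_one]
  have hε : Algebra.TensorProduct.rid k k (H a)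
      (Algebra.TensorProduct.map (AlgHom.id k (H a)) (counit k H)
        (Ring.inverse (rmatrix k H a 1))) = 1 := by
    have h1 : Algebra.TensorProduct.rid k k (H a)
        (Algebra.TensorProduct.map (AlgHom.id k (H a)) (counit k H) (rmatrix k H a 1)) = 1 :=
      counit_rmatrix_right a
    rw [← one_mul (Algebra.TensorProduct.rid k k (H a) _), ← h1, ← map_mul, ← map_mul,
      Ring.mul_inverse_cancel _ (isUnit_rmatrix a 1), map_one, map_one, h1]
  have key := congrArg N hinv
  rw [hl, hr, hε, map_one] at key
  exact left_inv_eq_right_inv key.symm (Ring.inverse_mul_cancel _ (isUnit_rmatrix a b'))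

theorem map_sphi_rmatrix (a b : π) :
    TensorProduct.map (sphi k H a) (LinearMap.id : H b →ₗ[k] H b) (rmatrix k H a⁻¹ b) =
      Ring.inverse (rmatrix k H a b) := by
  have key := antipode_rmatrix_mul_rmatrix (k := k) (H := H) (a := a⁻¹) (b := a) (g := b)
    (g' := a * b * a⁻¹) (inv_inv a).symm (by group)
  have e := congrArg (TensorProduct.map (antipodeOfEq k H (inv_inv a).symm) LinearMap.id)
    (map_id_crossingOfEq_rmatrix (k := k) (H := H) (mul_inv_cancel a) (a := a⁻¹) (a' := a⁻¹)
      (b := b) (b' := a * b * a⁻¹) (by group) (by group))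
  change TensorProduct.map _ LinearMap.id (TensorProduct.map LinearMap.id
      (crossingOfEq k H _ (by group)).toLinearMap _) = TensorProduct.map _ LinearMap.id
    (TensorProduct.map (crossingOfEq k H _ (by group)).toLinearMap LinearMap.id _) at e
  rw [← LinearMap.comp_apply, ← LinearMap.comp_apply, ← TensorProduct.map_comp,
    ← TensorProduct.map_comp] at e
  refine left_inv_eq_right_inv ?_ (Ring.mul_inverse_cancel _ (isUnit_rmatrix a b))
  rw [← key]
  exact congrArg (· * rmatrix k H a b) e.symm

theorem map_antipode_antipode_rmatrix (a b : π) :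
    TensorProduct.map (antipode k H a) (antipode k H b) (rmatrix k H a b) =
      TensorProduct.map (crossingOfEq k H a (a := a⁻¹) (b := a⁻¹) (by group)).toLinearMap
        LinearMap.id (rmatrix k H a⁻¹ b⁻¹) := by
  have hS : TensorProduct.map (antipode k H a) LinearMap.id (rmatrix k H a b) =
      Algebra.TensorProduct.map
        (crossingOfEq k H a (a := a⁻¹) (b := a⁻¹) (by group)).toAlgHom (AlgHom.id k (H b))
        (Ring.inverse (rmatrix k H a⁻¹ b)) := by
    have key := congrArg (Algebra.TensorProduct.map (AlgHom.id k (H a⁻¹))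
        (crossingOfEq k H a⁻¹ (a := a * b * a⁻¹) (b := b) (by group)).toAlgHom)
      (antipode_rmatrix_mul_rmatrix (k := k) (H := H) (a := a) (b := a⁻¹) (g := a * b * a⁻¹)
        (g' := b) rfl (by group))
    have hφ (t : H a ⊗[k] H b) : Algebra.TensorProduct.map (AlgHom.id k (H a⁻¹))
        (crossingOfEq k H a⁻¹ (a := a * b * a⁻¹) (b := b) (by group)).toAlgHom
        (TensorProduct.map (antipodeOfEq k H rfl) (crossingOfEq k H a⁻¹⁻¹ (a := b)
          (b := a * b * a⁻¹) (by group)).toLinearMap t) =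
        TensorProduct.map (antipode k H a) LinearMap.id t := by
      induction t with
      | zero => simp only [map_zero]
      | add x y hx hy => simp only [map_add, hx, hy]
      | tmul x y =>
        exact congrArg (antipode k H a x ⊗ₜ[k] ·)
          (crossingOfEq_inv_crossingOfEq (by group) (by group) (mul_inv_cancel _) y)
    rw [map_mul, map_one, hφ, map_id_crossingOfEq_rmatrix (mul_inv_cancel a) _ (a' := a⁻¹)
      (by group)] at key
    refine left_inv_eq_right_inv key ?_
    rw [← map_mul, Ring.mul_inverse_cancel _ (isUnit_rmatrix _ _), map_one]
  have e := congrArg (TensorProduct.map LinearMap.id (antipode k H b)) hS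
  rw [← map_antipode_inverse_rmatrix (k := k) (H := H) (a := a⁻¹) (b := b) rfl]
  change _ = TensorProduct.map LinearMap.id (antipode k H b)
    (TensorProduct.map (crossingOfEq k H _ (by group)).toLinearMap LinearMap.id _) at e
  change _ = TensorProduct.map (crossingOfEq k H _ (by group)).toLinearMap LinearMap.id
    (TensorProduct.map LinearMap.id (antipode k H b) _)
  rw [← LinearMap.comp_apply, ← LinearMap.comp_apply, ← TensorProduct.map_comp,
    ← TensorProduct.map_comp] at e
  rw [← LinearMap.comp_apply, ← TensorProduct.map_comp]
  exact e

theorem yang_baxter (a b g g' : π) (hg' : g' = b * g * b⁻¹) (hg : g = b⁻¹ * g' * b⁻¹⁻¹) :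
    (includeRight : _ →ₐ[k] H a ⊗[k] (H b ⊗[k] H g)) (rmatrix k H b g) *
      Algebra.TensorProduct.map (AlgHom.id k (H a)) includeRight (rmatrix k H a g) *
      Algebra.TensorProduct.map (AlgHom.id k (H a)) includeLeft (rmatrix k H a b) =
    Algebra.TensorProduct.map (AlgHom.id k (H a)) includeLeft (rmatrix k H a b) *
      Algebra.TensorProduct.map (AlgHom.id k (H a)) includeRight
        (Algebra.TensorProduct.map (AlgHom.id k (H a)) (crossingOfEq k H b⁻¹ hg).toAlgHom
          (rmatrix k H a g')) *
      (includeRight : _ →ₐ[k] H a ⊗[k] (H b ⊗[k] H g)) (rmatrix k H b g) := by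
  have h : b * g = g' * b := by rw [hg']; group
  let T : H g' ⊗[k] H b →ₐ[k] H b ⊗[k] H g :=
    (Algebra.TensorProduct.comm k (H g) (H b)).toAlgHom.comp
      (Algebra.TensorProduct.map (crossingOfEq k H b⁻¹ hg).toAlgHom (AlgHom.id k (H b)))
  have hT (t : H a ⊗[k] H (b * g)) :
      (includeRight : _ →ₐ[k] H a ⊗[k] (H b ⊗[k] H g)) (rmatrix k H b g) *
        Algebra.TensorProduct.map (AlgHom.id k (H a)) (comulOfEq k H rfl) t =
      Algebra.TensorProduct.map (AlgHom.id k (H a)) T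
        (Algebra.TensorProduct.map (AlgHom.id k (H a)) (comulOfEq k H h) t) *
        (includeRight : _ →ₐ[k] H a ⊗[k] (H b ⊗[k] H g)) (rmatrix k H b g) := by
    induction t with
    | zero => simp only [map_zero, mul_zero, zero_mul]
    | add x y hx hy => simp only [map_add, mul_add, add_mul, hx, hy]
    | tmul x y =>
      simp only [Algebra.TensorProduct.map_tmul, Algebra.TensorProduct.includeRight_apply,
        Algebra.TensorProduct.tmul_mul_tmul, one_mul, mul_one]
      exact congrArg (_ ⊗ₜ[k] ·) (rmatrix_mul_comul hg' hg h y)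
  rw [mul_assoc, ← map_comulOfEq_rmatrix_right rfl, hT, map_comulOfEq_rmatrix_right h, map_mul]
  simp only [← AlgHom.comp_apply, ← Algebra.TensorProduct.map_comp]
  congr 4
  ext; simp [T]

end Quasitriangular

end QTHopfGCoalgebra

/-- Lemma 6.3: properties of the R-matrix of a quasitriangular Hopf `π`-coalgebra,
including the Yang–Baxter equation. -/
theorem rmatrix_properties (k : Type*) [Field k] {π : Type*} [Group π]
    (H : π → Type*) [∀ α, Ring (H α)] [∀ α, Algebra k (H α)] [QTHopfGCoalgebra k H] :
    -- (a) `(ε ⊗ id)(R_{1,α}) = 1_α = (id ⊗ ε)(R_{α,1})`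
    (∀ α : π,
      (TensorProduct.lid k (H α))
          (TensorProduct.map (counit k H).toLinearMap (LinearMap.id : H α →ₗ[k] H α)
            (rmatrix k H 1 α)) = (1 : H α) ∧
      (TensorProduct.rid k (H α))
          (TensorProduct.map (LinearMap.id : H α →ₗ[k] H α) (counit k H).toLinearMap
            (rmatrix k H α 1)) = (1 : H α)) ∧
    -- (b) `(S_{α⁻¹}φ_α ⊗ id)(R_{α⁻¹,β}) = R_{α,β}⁻¹` and `(id ⊗ S_β)(R_{α,β}⁻¹) = R_{α,β⁻¹}`
    (∀ α β : π,
      TensorProduct.map (sphi k H α) (LinearMap.id : H β →ₗ[k] H β)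
          (rmatrix k H α⁻¹ β) = Ring.inverse (rmatrix k H α β) ∧
      TensorProduct.map (LinearMap.id : H α →ₗ[k] H α) (antipode k H β)
          (Ring.inverse (rmatrix k H α β)) = rmatrix k H α β⁻¹) ∧
    -- (c) `(S_α ⊗ S_β)(R_{α,β}) = (φ_α ⊗ id)(R_{α⁻¹,β⁻¹})`
    (∀ α β : π,
      TensorProduct.map (antipode k H α) (antipode k H β) (rmatrix k H α β)
        = TensorProduct.map
            ((gcast k H (show α * α⁻¹ * α⁻¹ = α⁻¹ by group)).toLinearMap ∘ₗ
              (crossing k H α α⁻¹).toLinearMap)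
            (LinearMap.id : H β⁻¹ →ₗ[k] H β⁻¹) (rmatrix k H α⁻¹ β⁻¹)) ∧
    -- (d) the Yang–Baxter equation in `H α ⊗ H β ⊗ H γ`
    (∀ α β γ : π,
      (TensorProduct.mk k (H α) (H β ⊗[k] H γ) 1 (rmatrix k H β γ))
          * (TensorProduct.map (LinearMap.id : H α →ₗ[k] H α)
              (TensorProduct.mk k (H β) (H γ) 1) (rmatrix k H α γ))
          * (TensorProduct.map (LinearMap.id : H α →ₗ[k] H α)
              ((TensorProduct.mk k (H β) (H γ)).flip 1) (rmatrix k H α β))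
        = (TensorProduct.map (LinearMap.id : H α →ₗ[k] H α)
              ((TensorProduct.mk k (H β) (H γ)).flip 1) (rmatrix k H α β))
          * (TensorProduct.map (LinearMap.id : H α →ₗ[k] H α)
              (TensorProduct.mk k (H β) (H γ) 1)
              (TensorProduct.map (LinearMap.id : H α →ₗ[k] H α)
                ((gcast k H (show β⁻¹ * (β * γ * β⁻¹) * β⁻¹⁻¹ = γ by group)).toLinearMap ∘ₗ
                  (crossing k H β⁻¹ (β * γ * β⁻¹)).toLinearMap)
                (rmatrix k H α (β * γ * β⁻¹))))
          * (TensorProduct.mk k (H α) (H β ⊗[k] H γ) 1 (rmatrix k H β γ))) := by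
  exact ⟨fun α => ⟨counit_rmatrix_left α, counit_rmatrix_right α⟩,
    fun α β => ⟨map_sphi_rmatrix α β, map_antipode_inverse_rmatrix rfl⟩,
    map_antipode_antipode_rmatrix, fun α β γ => yang_baxter α β γ _ rfl (by group)⟩
end
end

section
/- Let H be a quasitriangular Hopf π-coalgebra over a field k with crossing φ and R-matrix R, and for α ∈ π let u_α = m_α ∘ (S_{α⁻¹}φ_α ⊗ id_{H_α}) ∘ σ_{α,α⁻¹}(R_{α,α⁻¹}) ∈ H_α be the Drinfeld element. Then for all α, β ∈ π: (a) u_α is invertible with u_α⁻¹ = m_α ∘ (id_{H_α} ⊗ S_{α⁻¹}S_α) ∘ σ_{α,α}(R_{α,α}); (b) S_{α⁻¹}(S_α(φ_α(x))) = u_α x u_α⁻¹ for all x ∈ H_α; (c) the antipode of H is bijective; (d) φ_β(u_α) = u_{βαβ⁻¹}; (e) ε(u_1) = 1. -/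
open scoped TensorProduct

noncomputable section

open HopfGCoalgebra
open CrossedHopfGCoalgebra

open QTHopfGCoalgebra

namespace HopfGCoalgebra

section Hopf

variable (k : Type*) [Field k] {π : Type*} [Group π] (H : π → Type*)
  [∀ α, Ring (H α)] [∀ α, Algebra k (H α)] [HopfGCoalgebra k H]

/-- The comultiplication `H c → H a ⊗ H b` along an equality `a * b = c`. -/
def comulOf {a b c : π} (h : a * b = c) : H c →ₐ[k] H a ⊗[k] H b :=
  (comul k H a b).comp (gcast k H h.symm).toAlgHom

/-- The antipode `H a → H b` along an equality `a * b = 1`. -/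
def antipodeOf {a b : π} (h : a * b = 1) : H a →ₗ[k] H b :=
  (gcast k H (inv_eq_of_mul_eq_one_right h)).toLinearMap ∘ₗ antipode k H a

variable {k H}

theorem comulOf_coassoc {a b c ab bc d : π} (hab : a * b = ab) (hbc : b * c = bc)
    (h₁ : ab * c = d) (h₂ : a * bc = d) (x : H d) :
    TensorProduct.assoc k (H a) (H b) (H c)
        (TensorProduct.map (comulOf k H hab).toLinearMap LinearMap.id (comulOf k H h₁ x))
      = TensorProduct.map LinearMap.id (comulOf k H hbc).toLinearMap (comulOf k H h₂ x) := by
  subst hab hbc h₁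
  exact LinearMap.congr_fun (coassoc (k := k) (H := H) a b c) x

theorem comulOf_counit_right {a : π} (h : a * 1 = a) (x : H a) :
    TensorProduct.rid k (H a)
      (TensorProduct.map LinearMap.id (counit k H).toLinearMap (comulOf k H h x)) = x :=
  LinearMap.congr_fun (counit_right (k := k) (H := H) a) x

theorem comulOf_counit_left {a : π} (h : 1 * a = a) (x : H a) :
    TensorProduct.lid k (H a)
      (TensorProduct.map (counit k H).toLinearMap LinearMap.id (comulOf k H h x)) = x :=
  LinearMap.congr_fun (counit_left (k := k) (H := H) a) x

theorem antipodeOf_left {a b : π} (h : a * b = 1) (h' : b * a = 1) (x : H (1 : π)) :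
    LinearMap.mul' k (H a)
        (TensorProduct.map (antipodeOf k H h') LinearMap.id (comulOf k H h' x))
      = algebraMap k (H a) (counit k H x) := by
  obtain rfl : b = a⁻¹ := eq_inv_of_mul_eq_one_left h'
  have key := LinearMap.congr_fun (antipode_left (k := k) (H := H) a) (gcast k H h'.symm x)
  refine key.trans ?_
  have : ∀ {c : π} (e : c = 1) (y : H (1 : π)), (gcast k H e) (gcast k H e.symm y) = y := by
    intro c e y; subst e; rfl
  simp only [LinearMap.comp_apply, AlgEquiv.toLinearMap_apply, this]
  rfl

theorem antipodeOf_right {a b : π} (h : a * b = 1) (h' : b * a = 1) (x : H (1 : π)) :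
    LinearMap.mul' k (H a)
        (TensorProduct.map LinearMap.id (antipodeOf k H h') (comulOf k H h x))
      = algebraMap k (H a) (counit k H x) := by
  obtain rfl : b = a⁻¹ := eq_inv_of_mul_eq_one_left h'
  have key := LinearMap.congr_fun (antipode_right (k := k) (H := H) a) (gcast k H h.symm x)
  refine key.trans ?_
  have : ∀ {c : π} (e : c = 1) (y : H (1 : π)), (gcast k H e) (gcast k H e.symm y) = y := by
    intro c e y; subst e; rfl
  simp only [LinearMap.comp_apply, AlgEquiv.toLinearMap_apply, this]
  rfl

end Hopf

section Crossed

variable (k : Type*) [Field k] {π : Type*} [Group π] (H : π → Type*)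
  [∀ α, Ring (H α)] [∀ α, Algebra k (H α)] [CrossedHopfGCoalgebra k H]

/-- The crossing `φ_β : H a → H b` along an equality `β * a = b * β`. -/
def crossingOf (β : π) {a b : π} (h : β * a = b * β) : H a →ₐ[k] H b :=
  (gcast k H (mul_inv_eq_of_eq_mul h)).toAlgHom.comp (crossing k H β a).toAlgHom

variable {k H}

theorem crossingOf_comul (β : π) {a b c a' b' c' : π} (ha : β * a = a' * β) (hb : β * b = b' * β)
    (hc : β * c = c' * β) (h : a * b = c) (h' : a' * b' = c') (x : H c) :
    TensorProduct.map (crossingOf k H β ha).toLinearMap (crossingOf k H β hb).toLinearMap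
        (comulOf k H h x)
      = comulOf k H h' (crossingOf k H β hc x) := by
  obtain rfl := mul_inv_eq_of_eq_mul ha
  obtain rfl := mul_inv_eq_of_eq_mul hb
  subst h h'
  exact LinearMap.congr_fun (φ_comul (k := k) (H := H) β a b) x

theorem counit_crossingOf (β : π) (h : β * 1 = 1 * β) (x : H (1 : π)) :
    counit k H (crossingOf k H β h x) = counit k H x :=
  φ_counit (k := k) (H := H) β x

theorem crossingOf_crossingOf {β γ δ a b c : π} (hδ : β * γ = δ) (h : γ * a = b * γ)
    (h' : β * b = c * β) (h'' : δ * a = c * δ) (x : H a) :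
    crossingOf k H β h' (crossingOf k H γ h x) = crossingOf k H δ h'' x := by
  obtain rfl := mul_inv_eq_of_eq_mul h
  obtain rfl := mul_inv_eq_of_eq_mul h''
  subst hδ
  exact φ_mul (k := k) (H := H) β γ a x

theorem crossingOf_injective (β : π) {a b : π} (h : β * a = b * β) :
    Function.Injective (crossingOf k H β h) :=
  (gcast k H _).injective.comp (crossing k H β a).injective

theorem crossingOf_one {a : π} (h : 1 * a = a * 1) (x : H a) : crossingOf k H 1 h x = x :=
  crossingOf_injective 1 h (crossingOf_crossingOf (one_mul 1) h h h x)

end Crossed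

section Quasitriangular

variable {k : Type*} [Field k] {π : Type*} [Group π] {H : π → Type*}
  [∀ α, Ring (H α)] [∀ α, Algebra k (H α)] [QTHopfGCoalgebra k H]

theorem rmatrix_mul_comulOf {a b b' c : π} (h : a * b = c) (h' : b' * a = c)
    (hb : a⁻¹ * b' = b * a⁻¹) (x : H c) :
    rmatrix k H a b * comulOf k H h x
      = TensorProduct.comm k (H b) (H a)
          (TensorProduct.map (crossingOf k H a⁻¹ hb).toLinearMap LinearMap.id
            (comulOf k H h' x)) * rmatrix k H a b := by
  obtain rfl : b' = a * b * a⁻¹ := by rw [h, ← h']; group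
  subst h
  exact Rm_comul (k := k) (H := H) a b x

theorem rmatrix_comulOf_right {a b c d : π} (h : b * c = d) :
    TensorProduct.map LinearMap.id (comulOf k H h).toLinearMap (rmatrix k H a d)
      = TensorProduct.map LinearMap.id (TensorProduct.mk k (H b) (H c) 1) (rmatrix k H a c)
        * TensorProduct.map LinearMap.id ((TensorProduct.mk k (H b) (H c)).flip 1)
            (rmatrix k H a b) := by
  subst h
  exact Rm_delta_right (k := k) (H := H) a b c

theorem rmatrix_comulOf_left {a b c c' d : π} (h : a * b = d) (hc : b⁻¹ * c' = c * b⁻¹) :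
    TensorProduct.assoc k (H a) (H b) (H c)
        (TensorProduct.map (comulOf k H h).toLinearMap LinearMap.id (rmatrix k H d c))
      = TensorProduct.map LinearMap.id (TensorProduct.mk k (H b) (H c) 1)
          (TensorProduct.map LinearMap.id (crossingOf k H b⁻¹ hc).toLinearMap (rmatrix k H a c'))
        * TensorProduct.mk k (H a) (H b ⊗[k] H c) 1 (rmatrix k H b c) := by
  obtain rfl : c' = b * c * b⁻¹ := by rw [mul_assoc, ← hc]; group
  subst h
  exact Rm_delta_left (k := k) (H := H) a b c

theorem rmatrix_crossingOf (β : π) {a c a' c' : π} (ha : β * a = a' * β) (hc : β * c = c' * β) :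
    TensorProduct.map (crossingOf k H β ha).toLinearMap (crossingOf k H β hc).toLinearMap
        (rmatrix k H a c)
      = rmatrix k H a' c' := by
  obtain rfl := mul_inv_eq_of_eq_mul ha
  obtain rfl := mul_inv_eq_of_eq_mul hc
  exact Rm_phi (k := k) (H := H) β a c

end Quasitriangular

end HopfGCoalgebra

namespace HopfGCoalgebra

section AntipodeProperties

variable {k : Type*} [Field k] {π : Type*} [Group π] {H : π → Type*}
  [∀ α, Ring (H α)] [∀ α, Algebra k (H α)]

section Hopf

variable [HopfGCoalgebra k H]

/-- If `f * g` is the constant `c` and `g * f' = 1` for the convolution product, then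
`f = c f'`. -/
theorem eq_mul_of_convolution {A : Type*} [Ring A] [Algebra k A] {a b : π}
    (h : a * b = 1) (h' : b * a = 1) (f f' : H a →ₗ[k] A) (g : H b →ₗ[k] A) (c : A)
    (hl : ∀ x, LinearMap.mul' k A (TensorProduct.map f g (comulOf k H h x)) = counit k H x • c)
    (hr : ∀ x, LinearMap.mul' k A (TensorProduct.map g f' (comulOf k H h' x))
      = algebraMap k A (counit k H x)) (x : H a) : f x = c * f' x := by
  have hR : ∀ Y : H a ⊗[k] H (1 : π),
      LinearMap.mul' k A (TensorProduct.map f (LinearMap.mul' k A ∘ₗ TensorProduct.map g f')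
        (TensorProduct.map LinearMap.id (comulOf k H h').toLinearMap Y))
      = f (TensorProduct.rid k (H a)
          (TensorProduct.map LinearMap.id (counit k H).toLinearMap Y)) := by
    intro Y
    induction Y using TensorProduct.induction_on with
    | zero => simp
    | tmul p q => simp [hr, Algebra.algebraMap_eq_smul_one]
    | add p q hp hq => simp only [map_add, hp, hq]
  have hA : ∀ Z : (H a ⊗[k] H b) ⊗[k] H a,
      LinearMap.mul' k A (TensorProduct.map f (LinearMap.mul' k A ∘ₗ TensorProduct.map g f')
        (TensorProduct.assoc k _ _ _ Z))
      = LinearMap.mul' k A (TensorProduct.map (LinearMap.mul' k A ∘ₗ TensorProduct.map f g) f'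
          Z) := by
    intro Z
    induction Z using TensorProduct.induction_on with
    | zero => simp
    | tmul w r =>
      induction w using TensorProduct.induction_on with
      | zero => simp
      | tmul p q => simp [mul_assoc]
      | add p q hp hq => simp only [map_add, TensorProduct.add_tmul, hp, hq]
    | add p q hp hq => simp only [map_add, hp, hq]
  have hL : ∀ Y : H (1 : π) ⊗[k] H a,
      LinearMap.mul' k A (TensorProduct.map (LinearMap.mul' k A ∘ₗ TensorProduct.map f g) f'
        (TensorProduct.map (comulOf k H h).toLinearMap LinearMap.id Y))
      = c * f' (TensorProduct.lid k (H a)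
          (TensorProduct.map (counit k H).toLinearMap LinearMap.id Y)) := by
    intro Y
    induction Y using TensorProduct.induction_on with
    | zero => simp
    | tmul p q => simp [hl]
    | add p q hp hq => simp only [map_add, hp, hq, mul_add]
  have e := hR (comulOf k H (mul_one a) x)
  rwa [← comulOf_coassoc h h' (one_mul a), hA, hL, comulOf_counit_left, comulOf_counit_right,
    eq_comm] at e

theorem antipodeOf_one {a b : π} (h : a * b = 1) : antipodeOf k H h 1 = 1 := by
  have := antipodeOf_left (k := k) (H := H) (mul_eq_one_comm.mp h) h 1
  simpa [Algebra.TensorProduct.one_def] using this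

theorem antipodeOf_mul {a b : π} (h : a * b = 1) (x y : H a) :
    antipodeOf k H h (x * y) = antipodeOf k H h y * antipodeOf k H h x := by
  have h' : b * a = 1 := mul_eq_one_comm.mp h
  have contract : ∀ (z : H (1 : π)) (y : H a),
      LinearMap.mul' k (H b) (TensorProduct.map
        (antipodeOf k H h ∘ₗ LinearMap.mulRight k y) LinearMap.id (comulOf k H h z))
        = counit k H z • antipodeOf k H h y := by
    intro z y
    let F : H a ⊗[k] H b →ₗ[k] H a →ₗ[k] H b := TensorProduct.lift
      (LinearMap.mk₂ k (fun p q => LinearMap.mulRight k q ∘ₗ antipodeOf k H h ∘ₗ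
          LinearMap.mulLeft k p)
        (by intros; ext; simp [add_mul]) (by intros; ext; simp)
        (by intros; ext; simp [mul_add]) (by intros; ext; simp))
    have hF : ∀ (w : H a ⊗[k] H b) (y : H a), F w y = LinearMap.mul' k (H b)
        (TensorProduct.map (antipodeOf k H h ∘ₗ LinearMap.mulRight k y) LinearMap.id w) := by
      intro w y
      induction w using TensorProduct.induction_on with
      | zero => simp
      | tmul p q => simp [F]
      | add p q hp hq => simp only [map_add, hp, hq, LinearMap.add_apply]
    have hmul : ∀ w v : H a ⊗[k] H b,
        LinearMap.mul' k (H b) (TensorProduct.map (F w) LinearMap.id v)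
          = LinearMap.mul' k (H b)
              (TensorProduct.map (antipodeOf k H h) LinearMap.id (w * v)) := by
      intro w v
      induction w using TensorProduct.induction_on with
      | zero => simp
      | tmul p q =>
        induction v using TensorProduct.induction_on with
        | zero => simp
        | tmul r s => simp [F, mul_assoc]
        | add r s hr hs => simp only [map_add, mul_add, hr, hs]
      | add p q hp hq =>
        simp only [map_add, add_mul, TensorProduct.map_add_left, LinearMap.add_apply, hp, hq]
    rw [← hF]
    refine (eq_mul_of_convolution h h' (F (comulOf k H h z)) (antipodeOf k H h) LinearMap.id
      (algebraMap k (H b) (counit k H z)) (fun x => ?_) (fun x => ?_) y).trans ?_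
    · rw [hmul, ← map_mul, antipodeOf_left h' h, map_mul, mul_comm, map_mul, Algebra.smul_def]
    · exact antipodeOf_right h' h x
    · rw [Algebra.smul_def]
  exact eq_mul_of_convolution h h' (antipodeOf k H h ∘ₗ LinearMap.mulRight k y)
    (antipodeOf k H h) LinearMap.id (antipodeOf k H h y) (fun z => contract z y)
    (fun z => antipodeOf_right h' h z) x

theorem counit_antipodeOf (h : (1 : π) * 1 = 1) (x : H (1 : π)) :
    counit k H (antipodeOf k H h x) = counit k H x := by
  have := eq_mul_of_convolution h h ((counit k H).toLinearMap ∘ₗ antipodeOf k H h)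
    (counit k H).toLinearMap (counit k H).toLinearMap 1 (fun x => ?_) (fun x => ?_) x
  · simpa using this
  · have e := congrArg (counit k H) (antipodeOf_left (k := k) h h x)
    have : ∀ Y : H (1 : π) ⊗[k] H (1 : π), LinearMap.mul' k k (TensorProduct.map
        ((counit k H).toLinearMap ∘ₗ antipodeOf k H h) (counit k H).toLinearMap Y)
        = counit k H (LinearMap.mul' k _
            (TensorProduct.map (antipodeOf k H h) LinearMap.id Y)) := by
      intro Y
      induction Y using TensorProduct.induction_on with
      | zero => simp
      | tmul p q => simp
      | add p q hp hq => simp only [map_add, hp, hq]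
    rw [this, e]
    simp
  · have e := congrArg (counit k H) (comulOf_counit_left (k := k) h x)
    have : ∀ Y : H (1 : π) ⊗[k] H (1 : π), LinearMap.mul' k k (TensorProduct.map
        (counit k H).toLinearMap (counit k H).toLinearMap Y)
        = counit k H (TensorProduct.lid k _
            (TensorProduct.map (counit k H).toLinearMap LinearMap.id Y)) := by
      intro Y
      induction Y using TensorProduct.induction_on with
      | zero => simp
      | tmul p q => simp
      | add p q hp hq => simp only [map_add, hp, hq]
    rw [this, e]
    simp

variable (k H) in
/-- The antipode as an algebra morphism to the opposite algebra. -/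
def antipodeOp {a b : π} (h : a * b = 1) : H a →ₐ[k] (H b)ᵐᵒᵖ :=
  AlgHom.ofLinearMap ((MulOpposite.opLinearEquiv k).toLinearMap ∘ₗ antipodeOf k H h)
    (by simp [antipodeOf_one]) (by intro x y; simp [antipodeOf_mul])

@[simp]
theorem antipodeOp_apply {a b : π} (h : a * b = 1) (x : H a) :
    antipodeOp k H h x = MulOpposite.op (antipodeOf k H h x) := rfl

end Hopf

theorem antipodeOf_crossingOf [CrossedHopfGCoalgebra k H] (β : π) {a b a' b' : π}
    (h : a * b = 1) (h' : a' * b' = 1) (ha : β * a = a' * β) (hb : β * b = b' * β) (x : H a) :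
    antipodeOf k H h' (crossingOf k H β ha x) = crossingOf k H β hb (antipodeOf k H h x) := by
  have hba : b * a = 1 := mul_eq_one_comm.mp h
  have hba' : b' * a' = 1 := mul_eq_one_comm.mp h'
  have := eq_mul_of_convolution h hba (antipodeOf k H h' ∘ₗ (crossingOf k H β ha).toLinearMap)
    ((crossingOf k H β hb).toLinearMap ∘ₗ antipodeOf k H h)
    (crossingOf k H β hb).toLinearMap 1 (fun x => ?_) (fun x => ?_) x
  · simpa using this
  · have e := antipodeOf_left (k := k) hba' h' (crossingOf k H β (by simp : β * 1 = 1 * β) x)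
    rw [← crossingOf_comul β ha hb _ h h', ← LinearMap.comp_apply (TensorProduct.map _ _),
      ← TensorProduct.map_comp, counit_crossingOf] at e
    rw [← Algebra.algebraMap_eq_smul_one]
    exact e
  · have e := congrArg (crossingOf k H β hb) (antipodeOf_right (k := k) hba h x)
    rw [AlgHom.commutes] at e
    rw [← e]
    generalize comulOf k H hba x = Y
    induction Y using TensorProduct.induction_on with
    | zero => simp
    | tmul p q => simp
    | add p q hp hq => simp only [map_add, hp, hq]

end AntipodeProperties

end HopfGCoalgebra

namespace HopfGCoalgebra

section RMatrixProperties

variable {k : Type*} [Field k] {π : Type*} [Group π] {H : π → Type*}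
  [∀ α, Ring (H α)] [∀ α, Algebra k (H α)] [QTHopfGCoalgebra k H]

theorem isUnit_rmatrix (a b : π) : IsUnit (rmatrix k H a b) :=
  Rm_isUnit (k := k) (H := H) a b

theorem rmatrix_counit_left (c : π) :
    TensorProduct.lid k (H c) (TensorProduct.map (counit k H).toLinearMap LinearMap.id
      (rmatrix k H 1 c)) = 1 := by
  have hc : (1 : π)⁻¹ * c = c * (1 : π)⁻¹ := by simp
  set z := TensorProduct.lid k (H c) (TensorProduct.map (counit k H).toLinearMap LinearMap.id
    (rmatrix k H 1 c)) with hz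
  let E : H (1 : π) ⊗[k] (H (1 : π) ⊗[k] H c) →ₗ[k] H (1 : π) ⊗[k] H c :=
    (TensorProduct.lid k _).toLinearMap ∘ₗ
      TensorProduct.map (counit k H).toLinearMap LinearMap.id
  have hL : ∀ Y : H (1 : π) ⊗[k] H c, E (TensorProduct.assoc k _ _ _
      (TensorProduct.map (comulOf k H (one_mul 1)).toLinearMap LinearMap.id Y)) = Y := by
    intro Y
    induction Y using TensorProduct.induction_on with
    | zero => simp
    | tmul p q =>
      have : ∀ w : H (1 : π) ⊗[k] H (1 : π), E (TensorProduct.assoc k _ _ _ (w ⊗ₜ[k] q))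
          = (TensorProduct.lid k _ (TensorProduct.map (counit k H).toLinearMap
              LinearMap.id w)) ⊗ₜ[k] q := by
        intro w
        induction w using TensorProduct.induction_on with
        | zero => simp
        | tmul r s => simp [E, TensorProduct.smul_tmul']
        | add r s hr hs => simp only [map_add, TensorProduct.add_tmul, hr, hs]
      simp [this, comulOf_counit_left]
    | add p q hp hq => simp only [map_add, hp, hq]
  have hR : ∀ X Y : H (1 : π) ⊗[k] H c,
      E (TensorProduct.map LinearMap.id (TensorProduct.mk k (H (1 : π)) (H c) 1)
          (TensorProduct.map LinearMap.id (crossingOf k H 1⁻¹ hc).toLinearMap X)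
        * TensorProduct.mk k (H (1 : π)) (H (1 : π) ⊗[k] H c) 1 Y)
      = (1 ⊗ₜ[k] crossingOf k H 1⁻¹ hc (TensorProduct.lid k (H c)
          (TensorProduct.map (counit k H).toLinearMap LinearMap.id X))) * Y := by
    intro X Y
    induction X using TensorProduct.induction_on with
    | zero => simp
    | tmul p q => simp [E]
    | add p q hp hq => simp only [map_add, add_mul, TensorProduct.tmul_add, hp, hq]
  have key := congrArg E (rmatrix_comulOf_left (k := k) (H := H) (one_mul 1) hc)
  rw [hL, hR, ← hz, eq_comm] at key
  have h1 := (isUnit_rmatrix (k := k) (H := H) 1 c).mul_eq_right.mp key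
  have h2 := congrArg (fun w => TensorProduct.lid k (H c)
    (TensorProduct.map (counit k H).toLinearMap LinearMap.id w)) h1
  simp only [Algebra.TensorProduct.one_def, TensorProduct.map_tmul, AlgHom.toLinearMap_apply,
    map_one, LinearMap.id_apply, TensorProduct.lid_tmul, one_smul] at h2
  exact crossingOf_injective _ hc (h2.trans (map_one _).symm)

theorem rmatrix_counit_right (a : π) :
    TensorProduct.rid k (H a) (TensorProduct.map LinearMap.id (counit k H).toLinearMap
      (rmatrix k H a 1)) = 1 := by
  set z := TensorProduct.rid k (H a) (TensorProduct.map LinearMap.id (counit k H).toLinearMap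
    (rmatrix k H a 1)) with hz
  let E : H a ⊗[k] (H (1 : π) ⊗[k] H (1 : π)) →ₗ[k] H a ⊗[k] H (1 : π) :=
    TensorProduct.map LinearMap.id ((TensorProduct.rid k _).toLinearMap ∘ₗ
      TensorProduct.map LinearMap.id (counit k H).toLinearMap)
  have hL : ∀ Y : H a ⊗[k] H (1 : π),
      E (TensorProduct.map LinearMap.id (comulOf k H (one_mul 1)).toLinearMap Y) = Y := by
    intro Y
    induction Y using TensorProduct.induction_on with
    | zero => simp
    | tmul p q => simp [E, comulOf_counit_right]
    | add p q hp hq => simp only [map_add, hp, hq]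
  have hR : ∀ X Y : H a ⊗[k] H (1 : π),
      E (TensorProduct.map LinearMap.id (TensorProduct.mk k (H (1 : π)) (H (1 : π)) 1) X
        * TensorProduct.map LinearMap.id ((TensorProduct.mk k (H (1 : π)) (H (1 : π))).flip 1) Y)
      = (TensorProduct.rid k (H a) (TensorProduct.map LinearMap.id
          (counit k H).toLinearMap X) ⊗ₜ[k] 1) * Y := by
    intro X Y
    induction X using TensorProduct.induction_on with
    | zero => simp
    | tmul p q =>
      induction Y using TensorProduct.induction_on with
      | zero => simp
      | tmul r s => simp [E, TensorProduct.smul_tmul']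
      | add r s hr hs => simp only [map_add, mul_add, hr, hs]
    | add p q hp hq => simp only [map_add, add_mul, TensorProduct.add_tmul, hp, hq]
  have key := congrArg E (rmatrix_comulOf_right (k := k) (H := H) (a := a) (one_mul 1))
  rw [hL, hR, ← hz, eq_comm] at key
  have h1 := (isUnit_rmatrix (k := k) (H := H) a 1).mul_eq_right.mp key
  have h2 := congrArg (fun w => TensorProduct.rid k (H a)
    (TensorProduct.map LinearMap.id (counit k H).toLinearMap w)) h1
  simpa [Algebra.TensorProduct.one_def] using h2

/-- `(S ⊗ id)(R)` is a right inverse of `(id ⊗ φ)(R)`. -/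
theorem rmatrix_mul_antipode {a b c c' : π} (h : a * b = 1) (h' : b * a = 1)
    (hc : a * c' = c * a) :
    TensorProduct.map LinearMap.id (crossingOf k H a hc).toLinearMap (rmatrix k H a c')
      * TensorProduct.map (antipodeOf k H h') LinearMap.id (rmatrix k H b c) = 1 := by
  obtain rfl : a = b⁻¹ := eq_inv_of_mul_eq_one_left h
  let E : H b⁻¹ ⊗[k] (H b ⊗[k] H c) →ₗ[k] H b⁻¹ ⊗[k] H c :=
    TensorProduct.map (LinearMap.mul' k _ ∘ₗ TensorProduct.map LinearMap.id (antipodeOf k H h'))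
      LinearMap.id ∘ₗ (TensorProduct.assoc k _ _ _).symm.toLinearMap
  have hL : ∀ Y : H (1 : π) ⊗[k] H c, E (TensorProduct.assoc k _ _ _
      (TensorProduct.map (comulOf k H h).toLinearMap LinearMap.id Y))
      = 1 ⊗ₜ[k] (TensorProduct.lid k (H c) (TensorProduct.map (counit k H).toLinearMap
          LinearMap.id Y)) := by
    intro Y
    induction Y using TensorProduct.induction_on with
    | zero => simp
    | tmul p q =>
      simp [E, antipodeOf_right h h', Algebra.algebraMap_eq_smul_one, TensorProduct.smul_tmul]
    | add p q hp hq => simp only [map_add, TensorProduct.tmul_add, hp, hq]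
  have hR : ∀ (X : H b⁻¹ ⊗[k] H c) (Y : H b ⊗[k] H c),
      E (TensorProduct.map LinearMap.id (TensorProduct.mk k (H b) (H c) 1) X
        * TensorProduct.mk k (H b⁻¹) (H b ⊗[k] H c) 1 Y)
      = X * TensorProduct.map (antipodeOf k H h') LinearMap.id Y := by
    intro X Y
    induction X using TensorProduct.induction_on with
    | zero => simp
    | tmul p q =>
      induction Y using TensorProduct.induction_on with
      | zero => simp
      | tmul r s => simp [E]
      | add r s hr hs => simp only [map_add, mul_add, hr, hs]
    | add p q hp hq => simp only [map_add, add_mul, hp, hq]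
  have key := congrArg E (rmatrix_comulOf_left (k := k) (H := H) h hc)
  rw [hL, hR, rmatrix_counit_left] at key
  exact key.symm

theorem antipode_mul_rmatrix {a b c c' : π} (h : a * b = 1) (h' : b * a = 1)
    (hc : a * c' = c * a) :
    TensorProduct.map (antipodeOf k H h') LinearMap.id (rmatrix k H b c)
      * TensorProduct.map LinearMap.id (crossingOf k H a hc).toLinearMap (rmatrix k H a c')
      = 1 := by
  have hu : IsUnit (TensorProduct.map LinearMap.id (crossingOf k H a hc).toLinearMap
      (rmatrix k H a c')) :=
    (isUnit_rmatrix a c').map (Algebra.TensorProduct.map (AlgHom.id k (H a)) (crossingOf k H a hc))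
  have e := rmatrix_mul_antipode (k := k) (H := H) h h' hc
  rw [← hu.mul_right_inj, ← mul_assoc, e, one_mul, mul_one]

/-- In `H a ⊗ (H c)ᵐᵒᵖ`, the R-matrix is a right inverse of `(id ⊗ S)(R)`. -/
theorem antipodeOp_rmatrix_mul {a c c' : π} (h : c * c' = 1) (h' : c' * c = 1) :
    Algebra.TensorProduct.map (AlgHom.id k (H a)) (antipodeOp k H h') (rmatrix k H a c')
      * TensorProduct.map LinearMap.id (MulOpposite.opLinearEquiv k).toLinearMap
          (rmatrix k H a c) = 1 := by
  let E : H a ⊗[k] (H c ⊗[k] H c') →ₗ[k] H a ⊗[k] (H c)ᵐᵒᵖ :=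
    TensorProduct.map LinearMap.id ((MulOpposite.opLinearEquiv k).toLinearMap ∘ₗ
      LinearMap.mul' k _ ∘ₗ TensorProduct.map LinearMap.id (antipodeOf k H h'))
  have hL : ∀ Y : H a ⊗[k] H (1 : π),
      E (TensorProduct.map LinearMap.id (comulOf k H h).toLinearMap Y)
      = (TensorProduct.rid k (H a) (TensorProduct.map LinearMap.id (counit k H).toLinearMap
          Y)) ⊗ₜ[k] 1 := by
    intro Y
    induction Y using TensorProduct.induction_on with
    | zero => simp
    | tmul p q =>
      simp [E, antipodeOf_right h h', Algebra.algebraMap_eq_smul_one, TensorProduct.smul_tmul]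
    | add p q hp hq => simp only [map_add, TensorProduct.add_tmul, hp, hq]
  have hR : ∀ (X : H a ⊗[k] H c') (Y : H a ⊗[k] H c),
      E (TensorProduct.map LinearMap.id (TensorProduct.mk k (H c) (H c') 1) X
        * TensorProduct.map LinearMap.id ((TensorProduct.mk k (H c) (H c')).flip 1) Y)
      = Algebra.TensorProduct.map (AlgHom.id k (H a)) (antipodeOp k H h') X
      * TensorProduct.map LinearMap.id (MulOpposite.opLinearEquiv k).toLinearMap Y := by
    intro X Y
    induction X using TensorProduct.induction_on with
    | zero => simp
    | tmul p q =>
      induction Y using TensorProduct.induction_on with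
      | zero => simp
      | tmul r s => simp [E]
      | add r s hr hs => simp only [map_add, mul_add, hr, hs]
    | add p q hp hq => simp only [map_add, add_mul, hp, hq]
  have key := congrArg E (rmatrix_comulOf_right (k := k) (H := H) (a := a) h)
  rw [hL, hR, rmatrix_counit_right] at key
  exact key.symm

/-- `(S ⊗ S)(R) = (id ⊗ φ)(R)`. -/
theorem rmatrix_antipode_antipode {a b c d e : π} (hba : b * a = 1) (hcd : c * d = 1)
    (he : a * e = d * a) :
    TensorProduct.map (antipodeOf k H hba) (antipodeOf k H hcd) (rmatrix k H b c)
      = TensorProduct.map LinearMap.id (crossingOf k H a he).toLinearMap (rmatrix k H a e) := by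
  have hab : a * b = 1 := mul_eq_one_comm.mp hba
  obtain rfl : e = a⁻¹ * d * a := by rw [mul_assoc, ← he]; group
  have hc : a * (a⁻¹ * c * a) = c * a := by group
  have hee : a⁻¹ * d * a * (a⁻¹ * c * a) = 1 := by
    have := mul_eq_one_comm.mp hcd
    calc _ = a⁻¹ * (d * c) * a := by group
      _ = 1 := by rw [this]; group
  have hee' := mul_eq_one_comm.mp hee
  let J := Algebra.TensorProduct.map (AlgHom.id k (H a)) (antipodeOp k H hcd)
  let O : H a ⊗[k] H d ≃ₗ[k] H a ⊗[k] (H d)ᵐᵒᵖ :=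
    TensorProduct.congr (LinearEquiv.refl k _) (MulOpposite.opLinearEquiv k)
  have hWX := congrArg J (antipode_mul_rmatrix (k := k) (H := H) hab hba hc)
  rw [map_mul, map_one] at hWX
  let P := Algebra.TensorProduct.map (AlgHom.id k (H a)) (AlgHom.op (crossingOf k H a he))
  have hXR := congrArg P (antipodeOp_rmatrix_mul (k := k) (H := H) (a := a) hee hee')
  rw [map_mul, map_one] at hXR
  have hX : ∀ X, P (Algebra.TensorProduct.map (AlgHom.id k (H a)) (antipodeOp k H hee') X)
      = J (TensorProduct.map LinearMap.id (crossingOf k H a hc).toLinearMap X) := by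
    intro X
    induction X using TensorProduct.induction_on with
    | zero => simp
    | tmul p q => simp [P, J, antipodeOf_crossingOf a hee' hcd hc he]
    | add p q hp hq => simp only [map_add, hp, hq]
  rw [hX] at hXR
  have hO := left_inv_eq_right_inv hWX hXR
  apply O.injective
  refine Eq.trans ?_ (hO.trans ?_)
  · generalize rmatrix k H b c = Y
    induction Y using TensorProduct.induction_on with
    | zero => simp
    | tmul p q => simp [O, J]
    | add p q hp hq => simp only [map_add, hp, hq]
  · generalize rmatrix k H a (a⁻¹ * d * a) = Y
    induction Y using TensorProduct.induction_on with
    | zero => simp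
    | tmul p q => simp [O, P]
    | add p q hp hq => simp only [map_add, hp, hq]

theorem rmatrix_antipode_sq {a b c d : π} (hba : b * a = 1) (hab : a * b = 1)
    (hcd : c * d = 1) (hdc : d * c = 1) :
    TensorProduct.map (antipodeOf k H hab ∘ₗ antipodeOf k H hba)
      (antipodeOf k H hdc ∘ₗ antipodeOf k H hcd) (rmatrix k H b c) = rmatrix k H b c := by
  have he : a * (a⁻¹ * d * a) = d * a := by group
  have hc : a * (a⁻¹ * c * a) = c * a := by group
  have hee : a⁻¹ * d * a * (a⁻¹ * c * a) = 1 := by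
    calc _ = a⁻¹ * (d * c) * a := by group
      _ = 1 := by rw [hdc]; group
  have hb : b * c = a⁻¹ * c * a * b := by
    rw [eq_inv_of_mul_eq_one_left hba]; group
  rw [TensorProduct.map_comp, LinearMap.comp_apply, rmatrix_antipode_antipode hba hcd he]
  have comm : ∀ Y : H a ⊗[k] H (a⁻¹ * d * a),
      TensorProduct.map (antipodeOf k H hab) (antipodeOf k H hdc)
        (TensorProduct.map LinearMap.id (crossingOf k H a he).toLinearMap Y)
      = TensorProduct.map LinearMap.id (crossingOf k H a hc).toLinearMap
        (TensorProduct.map (antipodeOf k H hab) (antipodeOf k H hee) Y) := by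
    intro Y
    induction Y using TensorProduct.induction_on with
    | zero => simp
    | tmul p q => simp [antipodeOf_crossingOf a hee hdc he hc]
    | add p q hp hq => simp only [map_add, hp, hq]
  rw [comm, rmatrix_antipode_antipode hab hee hb]
  generalize rmatrix k H b c = Y
  induction Y using TensorProduct.induction_on with
  | zero => simp
  | tmul p q =>
    simp [crossingOf_crossingOf hab hb hc (by simp : 1 * c = c * 1), crossingOf_one]
  | add p q hp hq => simp only [map_add, hp, hq]

end RMatrixProperties

end HopfGCoalgebra

namespace HopfGCoalgebra

section Drinfeld

variable {k : Type*} [Field k] {π : Type*} [Group π] {H : π → Type*}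
  [∀ α, Ring (H α)] [∀ α, Algebra k (H α)] [QTHopfGCoalgebra k H]

theorem drinfeld_eq {a b : π} (h : b * a = 1) (hb : a * b = b * a) :
    drinfeld k H a = LinearMap.mul' k (H a)
      (TensorProduct.map (antipodeOf k H h ∘ₗ (crossingOf k H a hb).toLinearMap) LinearMap.id
        (TensorProduct.comm k (H a) (H b) (rmatrix k H a b))) := by
  obtain rfl : b = a⁻¹ := eq_inv_of_mul_eq_one_left h
  rfl

theorem antipodeSq_eq {a b : π} (h : a * b = 1) (h' : b * a = 1) :
    antipodeSq k H a = antipodeOf k H h' ∘ₗ antipodeOf k H h := by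
  obtain rfl : b = a⁻¹ := eq_inv_of_mul_eq_one_left h'
  rfl

theorem antipodeSq_crossingOf (β : π) {a a' : π} (ha : β * a = a' * β) (x : H a) :
    antipodeSq k H a' (crossingOf k H β ha x) = crossingOf k H β ha (antipodeSq k H a x) := by
  have hb : β * a⁻¹ = a'⁻¹ * β := by rw [eq_inv_mul_iff_mul_eq, ← mul_assoc, ← ha]; group
  simp [antipodeSq_eq (mul_inv_cancel a) (inv_mul_cancel a),
    antipodeSq_eq (mul_inv_cancel a') (inv_mul_cancel a'),
    antipodeOf_crossingOf β (mul_inv_cancel a) (mul_inv_cancel a') ha hb,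
    antipodeOf_crossingOf β (inv_mul_cancel a) (inv_mul_cancel a') hb ha]

theorem crossingOf_crossingOf_of_mul_eq_one {a b c d : π} (h : a * b = 1) (hc : b * c = d * b)
    (hd : a * d = c * a) (x : H c) :
    crossingOf k H a hd (crossingOf k H b hc x) = x := by
  rw [crossingOf_crossingOf h hc hd (by simp : 1 * c = c * 1), crossingOf_one]

/-- `S(φ_a(y₂)) u_a y₁ = ε(y) u_a`. -/
theorem antipodeOf_crossingOf_mul_drinfeld_mul {a b : π} (h : a * b = 1) (h' : b * a = 1)
    (hb : a * b = b * a) (y : H (1 : π)) :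
    LinearMap.mul' k (H a) (TensorProduct.map
        (antipodeOf k H h' ∘ₗ (crossingOf k H a hb).toLinearMap)
        (LinearMap.mulLeft k (drinfeld k H a))
        (TensorProduct.comm k (H a) (H b) (comulOf k H h y)))
      = counit k H y • drinfeld k H a := by
  have hb' : a⁻¹ * b = b * a⁻¹ := by rw [eq_inv_of_mul_eq_one_left h']
  let U : H a ⊗[k] H b →ₗ[k] H a := LinearMap.mul' k (H a) ∘ₗ
    TensorProduct.map (antipodeOf k H h' ∘ₗ (crossingOf k H a hb).toLinearMap) LinearMap.id ∘ₗ
    (TensorProduct.comm k (H a) (H b)).toLinearMap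
  have hU : drinfeld k H a = U (rmatrix k H a b) := drinfeld_eq h' hb
  have hL : ∀ X Y : H a ⊗[k] H b, U (X * Y) = LinearMap.mul' k (H a) (TensorProduct.map
        (antipodeOf k H h' ∘ₗ (crossingOf k H a hb).toLinearMap)
        (LinearMap.mulLeft k (U X)) (TensorProduct.comm k (H a) (H b) Y)) := by
    intro X Y
    induction Y using TensorProduct.induction_on with
    | zero => simp
    | tmul r s =>
      induction X using TensorProduct.induction_on with
      | zero => simp
      | tmul p q => simp [U, antipodeOf_mul, mul_assoc]
      | add p q hp hq =>
        rw [add_mul, map_add, hp, hq]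
        simp [mul_add, add_mul]
    | add r s hr hs => simp only [map_add, mul_add, hr, hs]
  have hR : ∀ (Z : H b ⊗[k] H a) (p : H a) (q : H b), U (TensorProduct.comm k (H b) (H a)
      (TensorProduct.map (crossingOf k H a⁻¹ hb').toLinearMap LinearMap.id Z) * (p ⊗ₜ[k] q))
      = antipodeOf k H h' (crossingOf k H a hb q)
        * LinearMap.mul' k (H a) (TensorProduct.map (antipodeOf k H h') LinearMap.id Z) * p := by
    intro Z p q
    induction Z using TensorProduct.induction_on with
    | zero => simp
    | tmul r s =>
      simp [U, antipodeOf_mul, mul_assoc,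
        crossingOf_crossingOf_of_mul_eq_one (mul_inv_cancel a) hb' hb]
    | add r s hr hs => simp only [map_add, mul_add, add_mul, hr, hs]
  rw [hU, ← hL, rmatrix_mul_comulOf h h' hb']
  generalize rmatrix k H a b = X
  induction X using TensorProduct.induction_on with
  | zero => simp
  | tmul p q =>
    rw [hR, antipodeOf_left h h']
    simp [U, Algebra.algebraMap_eq_smul_one]
  | add p q hp hq => simp only [map_add, mul_add, hp, hq, smul_add]

/-- `S²(φ_a(x)) u_a = u_a x`. -/
theorem antipodeSq_crossingOf_mul_drinfeld (a : π) (ha : a * a = a * a) (x : H a) :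
    antipodeSq k H a (crossingOf k H a ha x) * drinfeld k H a = drinfeld k H a * x := by
  have h := mul_inv_cancel a
  have h' := inv_mul_cancel a
  have hb : a * a⁻¹ = a⁻¹ * a := by simp
  let op : H a →ₗ[k] (H a)ᵐᵒᵖ := (MulOpposite.opLinearEquiv k).toLinearMap
  have key := eq_mul_of_convolution h h' (op ∘ₗ LinearMap.mulLeft k (drinfeld k H a))
    (op ∘ₗ antipodeSq k H a ∘ₗ (crossingOf k H a ha).toLinearMap)
    (op ∘ₗ antipodeOf k H h' ∘ₗ (crossingOf k H a hb).toLinearMap)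
    (op (drinfeld k H a)) (fun y => ?_) (fun y => ?_) x
  · exact (MulOpposite.op_injective key).symm
  · rw [← map_smul, ← antipodeOf_crossingOf_mul_drinfeld_mul h h' hb]
    generalize comulOf k H h y = Y
    induction Y using TensorProduct.induction_on with
    | zero => simp
    | tmul p q => simp [op]
    | add p q hp hq => simp only [map_add, hp, hq]
  · have e := congrArg (fun z => op (antipodeOf k H h' (crossingOf k H a hb z)))
      (antipodeOf_right (k := k) h' h y)
    simp only [Algebra.algebraMap_eq_smul_one, map_smul, map_one, antipodeOf_one] at e
    rw [Algebra.algebraMap_eq_smul_one]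
    refine Eq.trans ?_ e
    generalize comulOf k H h' y = Y
    induction Y using TensorProduct.induction_on with
    | zero => simp
    | tmul p q =>
      simp [op, antipodeOf_mul, antipodeSq_eq h h', antipodeOf_crossingOf a h h ha hb]
    | add p q hp hq => simp only [map_add, hp, hq]

variable (k H) in
/-- The element `m(id ⊗ S²)σ(R_{a,a})`, inverse to the Drinfeld element. -/
def drinfeldInv (a : π) : H a :=
  LinearMap.mul' k (H a) (TensorProduct.map LinearMap.id (antipodeSq k H a)
    (TensorProduct.comm k (H a) (H a) (rmatrix k H a a)))

theorem drinfeld_mul_drinfeldInv (a : π) : drinfeld k H a * drinfeldInv k H a = 1 := by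
  have h := mul_inv_cancel a
  have h' := inv_mul_cancel a
  have hb : a * a⁻¹ = a⁻¹ * a := by simp
  let Q : H a ⊗[k] H a⁻¹ →ₗ[k] H a := LinearMap.mul' k (H a) ∘ₗ
    TensorProduct.map (antipodeOf k H h') LinearMap.id ∘ₗ
    (TensorProduct.comm k (H a) (H a⁻¹)).toLinearMap
  have hQ : drinfeld k H a = Q (TensorProduct.map LinearMap.id (crossingOf k H a hb).toLinearMap
      (rmatrix k H a a⁻¹)) := by
    rw [drinfeld_eq h' hb]
    generalize rmatrix k H a a⁻¹ = Y
    induction Y using TensorProduct.induction_on with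
    | zero => simp
    | tmul p q => simp [Q]
    | add p q hp hq => simp only [map_add, hp, hq]
  have hQmul : ∀ (X : H a ⊗[k] H a⁻¹) (s : H a) (t : H a⁻¹),
      Q (X * (s ⊗ₜ[k] t)) = antipodeOf k H h' t * Q X * s := by
    intro X s t
    induction X using TensorProduct.induction_on with
    | zero => simp
    | tmul p q => simp [Q, antipodeOf_mul, mul_assoc]
    | add p q hp hq => simp only [map_add, add_mul, mul_add, hp, hq]
  have hmul : ∀ Y : H a ⊗[k] H a,
      drinfeld k H a * LinearMap.mul' k (H a) (TensorProduct.map LinearMap.id (antipodeSq k H a)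
        (TensorProduct.comm k (H a) (H a) Y))
      = Q (TensorProduct.map LinearMap.id (crossingOf k H a hb).toLinearMap (rmatrix k H a a⁻¹)
          * TensorProduct.map (antipodeOf k H h') (crossingOf k H a hb).toLinearMap
            (TensorProduct.map (antipodeOf k H h) (antipodeOf k H h) Y)) := by
    intro Y
    induction Y using TensorProduct.induction_on with
    | zero => simp
    | tmul p q =>
      simp only [TensorProduct.map_tmul, hQmul, ← hQ, TensorProduct.comm_tmul,
        LinearMap.mul'_apply, LinearMap.id_apply, AlgHom.toLinearMap_apply,
        ← antipodeOf_crossingOf a h h rfl hb]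
      rw [← mul_assoc, ← antipodeSq_crossingOf_mul_drinfeld a rfl, antipodeSq_eq h h']
      rfl
    | add p q hp hq => simp only [map_add, mul_add, hp, hq]
  have hcancel : ∀ Y : H a⁻¹ ⊗[k] H a⁻¹,
      TensorProduct.map (antipodeOf k H h') (crossingOf k H a hb).toLinearMap
        (TensorProduct.map LinearMap.id (crossingOf k H a⁻¹ rfl).toLinearMap Y)
      = TensorProduct.map (antipodeOf k H h') LinearMap.id Y := by
    intro Y
    induction Y using TensorProduct.induction_on with
    | zero => simp
    | tmul p q => simp [crossingOf_crossingOf_of_mul_eq_one h rfl hb]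
    | add p q hp hq => simp only [map_add, hp, hq]
  rw [drinfeldInv, hmul, rmatrix_antipode_antipode h h rfl, hcancel, rmatrix_mul_antipode h h' hb]
  simp [Q, Algebra.TensorProduct.one_def, antipodeOf_one]

theorem drinfeldInv_mul_drinfeld (a : π) : drinfeldInv k H a * drinfeld k H a = 1 := by
  have h := mul_inv_cancel a
  have h' := inv_mul_cancel a
  have hb : a⁻¹ * a = a * a⁻¹ := by simp
  let G : H a ⊗[k] H a →ₗ[k] H a := LinearMap.mul' k (H a) ∘ₗ
    TensorProduct.map (LinearMap.mulRight k (drinfeld k H a)) (crossingOf k H a⁻¹ hb).toLinearMap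
      ∘ₗ (TensorProduct.comm k (H a) (H a)).toLinearMap
  have hsq : ∀ x : H a, antipodeSq k H a x * drinfeld k H a
      = drinfeld k H a * crossingOf k H a⁻¹ hb x := by
    intro x
    rw [← antipodeSq_crossingOf_mul_drinfeld a rfl,
      crossingOf_crossingOf_of_mul_eq_one h hb rfl]
  have hG : ∀ Y : H a ⊗[k] H a, LinearMap.mul' k (H a) (TensorProduct.map LinearMap.id
      (antipodeSq k H a) (TensorProduct.comm k (H a) (H a) Y)) * drinfeld k H a = G Y := by
    intro Y
    induction Y using TensorProduct.induction_on with
    | zero => simp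
    | tmul p q => simp [G, mul_assoc, hsq]
    | add p q hp hq => simp only [map_add, add_mul, hp, hq]
  have hG' : ∀ Y : H a ⊗[k] H a,
      G (TensorProduct.map (antipodeSq k H a) (antipodeSq k H a) Y)
      = drinfeld k H a * LinearMap.mul' k (H a) (TensorProduct.map LinearMap.id
          (antipodeSq k H a) (TensorProduct.comm k (H a) (H a) (TensorProduct.map
            (crossingOf k H a⁻¹ hb).toLinearMap (crossingOf k H a⁻¹ hb).toLinearMap Y))) := by
    intro Y
    induction Y using TensorProduct.induction_on with
    | zero => simp
    | tmul p q => simp [G, ← mul_assoc, hsq, antipodeSq_crossingOf]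
    | add p q hp hq => simp only [map_add, mul_add, hp, hq]
  have hR : TensorProduct.map (antipodeSq k H a) (antipodeSq k H a) (rmatrix k H a a)
      = rmatrix k H a a := by
    rw [antipodeSq_eq h h']
    exact rmatrix_antipode_sq h h' h h'
  rw [drinfeldInv, hG, ← hR, hG', rmatrix_crossingOf]
  exact drinfeld_mul_drinfeldInv a

theorem antipodeSq_bijective (a : π) : Function.Bijective (antipodeSq k H a) := by
  have hb : a⁻¹ * a = a * a⁻¹ := by simp
  have hP : ∀ x : H a, crossingOf k H a rfl (crossingOf k H a⁻¹ hb x) = x :=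
    crossingOf_crossingOf_of_mul_eq_one (mul_inv_cancel a) hb rfl
  have hu : IsUnit (drinfeld k H a) :=
    ⟨⟨_, _, drinfeld_mul_drinfeldInv a, drinfeldInv_mul_drinfeld a⟩, rfl⟩
  constructor
  · intro x y hxy
    have e : antipodeSq k H a x * drinfeld k H a = antipodeSq k H a y * drinfeld k H a := by
      rw [hxy]
    rw [← hP x, ← hP y, antipodeSq_crossingOf_mul_drinfeld, antipodeSq_crossingOf_mul_drinfeld,
      hu.mul_right_inj] at e
    exact crossingOf_injective _ hb e
  · intro y
    refine ⟨crossingOf k H a rfl (drinfeldInv k H a * y * drinfeld k H a), ?_⟩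
    rw [← hu.mul_left_inj, antipodeSq_crossingOf_mul_drinfeld, ← mul_assoc, ← mul_assoc,
      drinfeld_mul_drinfeldInv, one_mul]

theorem antipode_bijective (a : π) : Function.Bijective (antipode k H a) := by
  have h := mul_inv_cancel a
  have h' := inv_mul_cancel a
  change Function.Bijective (antipodeOf k H h)
  constructor
  · have e := (antipodeSq_bijective (k := k) (H := H) a).1
    rw [antipodeSq_eq h h', LinearMap.coe_comp] at e
    exact e.of_comp
  · have e := (antipodeSq_bijective (k := k) (H := H) a⁻¹).2
    rw [antipodeSq_eq h' h, LinearMap.coe_comp] at e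
    exact e.of_comp

theorem crossingOf_drinfeld (β : π) {a a' : π} (ha : β * a = a' * β) :
    crossingOf k H β ha (drinfeld k H a) = drinfeld k H a' := by
  have hb : a * a⁻¹ = a⁻¹ * a := by simp
  have hb' : a' * a'⁻¹ = a'⁻¹ * a' := by simp
  have hi : β * a⁻¹ = a'⁻¹ * β := by rw [eq_inv_mul_iff_mul_eq, ← mul_assoc, ← ha]; group
  rw [drinfeld_eq (inv_mul_cancel a) hb, drinfeld_eq (inv_mul_cancel a') hb',
    ← rmatrix_crossingOf β ha hi]
  generalize rmatrix k H a a⁻¹ = Y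
  have hφ : (β * a) * a⁻¹ = a'⁻¹ * (β * a) := by
    rw [ha, mul_assoc, hi]; group
  induction Y using TensorProduct.induction_on with
  | zero => simp
  | tmul p q =>
    simp [← antipodeOf_crossingOf β (inv_mul_cancel a) (inv_mul_cancel a') hi ha,
      crossingOf_crossingOf rfl hb hi hφ, crossingOf_crossingOf ha.symm hi hb' hφ]
  | add p q hp hq => simp only [map_add, hp, hq]

theorem counit_drinfeld_one : counit k H (drinfeld k H 1) = 1 := by
  rw [drinfeld_eq (b := 1) (one_mul 1) rfl]
  have e := congrArg (counit k H) (rmatrix_counit_right (k := k) (H := H) 1)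
  rw [map_one] at e
  refine Eq.trans ?_ e
  generalize rmatrix k H (1 : π) 1 = Y
  induction Y using TensorProduct.induction_on with
  | zero => simp
  | tmul p q => simp [counit_antipodeOf, counit_crossingOf]
  | add p q hp hq => simp only [map_add, hp, hq]

end Drinfeld

end HopfGCoalgebra

/-- Lemma 6.4: properties of the Drinfeld elements `u_α` of a quasitriangular Hopf
`π`-coalgebra. -/
theorem drinfeld_properties (k : Type*) [Field k] {π : Type*} [Group π]
    (H : π → Type*) [∀ α, Ring (H α)] [∀ α, Algebra k (H α)] [QTHopfGCoalgebra k H] :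
    -- (a) `u_α` is invertible, with inverse `m_α ∘ (id ⊗ S_{α⁻¹}S_α) ∘ σ_{α,α}(R_{α,α})`
    (∀ α : π, IsUnit (drinfeld k H α) ∧
      Ring.inverse (drinfeld k H α)
        = LinearMap.mul' k (H α)
            (TensorProduct.map (LinearMap.id : H α →ₗ[k] H α) (antipodeSq k H α)
              ((TensorProduct.comm k (H α) (H α)) (rmatrix k H α α)))) ∧
    -- (b) `S_{α⁻¹}(S_α(φ_α(x))) = u_α x u_α⁻¹`
    (∀ (α : π) (x : H α),
      antipodeSq k H α
          ((gcast k H (show α * α * α⁻¹ = α by group)) (crossing k H α α x))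
        = drinfeld k H α * x * Ring.inverse (drinfeld k H α)) ∧
    -- (c) the antipode is bijective
    (∀ α : π, Function.Bijective (antipode k H α)) ∧
    -- (d) `φ_β(u_α) = u_{βαβ⁻¹}`
    (∀ α β : π, crossing k H β α (drinfeld k H α) = drinfeld k H (β * α * β⁻¹)) ∧
    -- (e) `ε(u_1) = 1`
    counit k H (drinfeld k H 1) = 1 := by
  refine ⟨fun α => ?_, fun α x => ?_, antipode_bijective, fun α β => ?_, counit_drinfeld_one⟩
  · let U : (H α)ˣ := ⟨drinfeld k H α, drinfeldInv k H α, drinfeld_mul_drinfeldInv α,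
      drinfeldInv_mul_drinfeld α⟩
    exact ⟨U.isUnit, Ring.inverse_unit U⟩
  · have hu : IsUnit (drinfeld k H α) :=
      ⟨⟨_, _, drinfeld_mul_drinfeldInv α, drinfeldInv_mul_drinfeld α⟩, rfl⟩
    rw [← antipodeSq_crossingOf_mul_drinfeld α rfl, Ring.mul_inverse_cancel_right _ _ hu]
    rfl
  · exact crossingOf_drinfeld β (inv_mul_cancel_right (β * α) β).symm
end
end

section
/- Let H be a quasitriangular Hopf π-coalgebra over a field k with Drinfeld elements u_α = m_α ∘ (S_{α⁻¹}φ_α ⊗ id_{H_α}) ∘ σ_{α,α⁻¹}(R_{α,α⁻¹}), and for α ∈ π set ℓ_α = S_{α⁻¹}(u_{α⁻¹})⁻¹ u_α ∈ H_α (both u_α and S_{α⁻¹}(u_{α⁻¹}) are invertible, and S_{α⁻¹}(u_{α⁻¹})⁻¹ u_α = u_α S_{α⁻¹}(u_{α⁻¹})⁻¹). Then: (a) ℓ = (ℓ_α)_{α∈π} is a π-grouplike element of H; (b) (S_{α⁻¹} ∘ S_α)²(x) = ℓ_α x ℓ_α⁻¹ for all α ∈ π and x ∈ H_α. -/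
open scoped TensorProduct

noncomputable section

open HopfGCoalgebra
open CrossedHopfGCoalgebra

open QTHopfGCoalgebra

/-! ### Structure maps with free indices

The structure maps are composed with transports so that their source and target indices are
arbitrary group elements satisfying the relevant equation; all axioms then become cast-free. -/

section TensorMaps

variable {k A B C D : Type*} [Field k] [Ring A] [Ring B] [Ring C] [Ring D]
  [Algebra k A] [Algebra k B] [Algebra k C] [Algebra k D]

lemma tensorMap_mul (f : A →ₗ[k] C) (g : B →ₗ[k] D) (hf : ∀ x y, f (x * y) = f x * f y)
    (hg : ∀ x y, g (x * y) = g x * g y) (s t : A ⊗[k] B) :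
    TensorProduct.map f g (s * t) = TensorProduct.map f g s * TensorProduct.map f g t := by
  induction s with
  | zero => simp
  | add s s' hs hs' => simp only [add_mul, map_add, hs, hs']
  | tmul a b =>
    induction t with
    | zero => simp
    | add t t' ht ht' => simp only [mul_add, map_add, ht, ht']
    | tmul c d => simp [hf, hg]

lemma tensorMap_antimul (f : A →ₗ[k] C) (g : B →ₗ[k] D) (hf : ∀ x y, f (x * y) = f y * f x)
    (hg : ∀ x y, g (x * y) = g y * g x) (s t : A ⊗[k] B) :
    TensorProduct.map f g (s * t) = TensorProduct.map f g t * TensorProduct.map f g s := by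
  induction s with
  | zero => simp
  | add s s' hs hs' => simp only [add_mul, mul_add, map_add, hs, hs']
  | tmul a b =>
    induction t with
    | zero => simp
    | add t t' ht ht' => simp only [mul_add, add_mul, map_add, ht, ht']
    | tmul c d => simp [hf, hg]

lemma tensorComm_mul (s t : A ⊗[k] B) :
    TensorProduct.comm k A B (s * t) = TensorProduct.comm k A B s * TensorProduct.comm k A B t :=
  map_mul (Algebra.TensorProduct.comm k A B) s t

end TensorMaps

namespace HopfGCoalgebra

variable (k : Type*) [Field k] {π : Type*} [Group π] (H : π → Type*)
  [∀ α, Ring (H α)] [∀ α, Algebra k (H α)] [HopfGCoalgebra k H]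

/-- The comultiplication `H c → H a ⊗ H b` for `a * b = c`. -/
def comulTo {a b c : π} (h : a * b = c) : H c →ₐ[k] H a ⊗[k] H b :=
  (Δ a b).comp (gcast k H h.symm).toAlgHom

/-- The antipode `H a → H b` for `a * b = 1`. -/
def antipodeTo {a b : π} (h : a * b = 1) : H a →ₗ[k] H b :=
  (gcast k H (inv_eq_of_mul_eq_one_right h)).toLinearMap ∘ₗ S a

variable {a b c d : π}

lemma comulTo_coassoc {ab bc abc : π} (hab : a * b = ab) (hbc : b * c = bc) (h₁ : ab * c = abc)
    (h₂ : a * bc = abc) (x : H abc) :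
    TensorProduct.assoc k (H a) (H b) (H c)
        (TensorProduct.map (comulTo k H hab).toLinearMap LinearMap.id (comulTo k H h₁ x))
      = TensorProduct.map LinearMap.id (comulTo k H hbc).toLinearMap (comulTo k H h₂ x) := by
  subst hab hbc h₁
  exact LinearMap.congr_fun (coassoc (k := k) (H := H) a b c) x

lemma comulTo_counit_right (h : a * 1 = a) (x : H a) :
    TensorProduct.rid k (H a)
      (TensorProduct.map LinearMap.id (ε (k := k) (H := H)).toLinearMap (comulTo k H h x)) = x :=
  LinearMap.congr_fun (counit_right (k := k) (H := H) a) x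

lemma comulTo_counit_left (h : 1 * a = a) (x : H a) :
    TensorProduct.lid k (H a)
      (TensorProduct.map (ε (k := k) (H := H)).toLinearMap LinearMap.id (comulTo k H h x)) = x :=
  LinearMap.congr_fun (counit_left (k := k) (H := H) a) x

lemma antipodeTo_comulTo_left (h h' : a * b = 1) (x : H 1) :
    LinearMap.mul' k (H b)
        (TensorProduct.map (antipodeTo k H h) LinearMap.id (comulTo k H h' x))
      = algebraMap k (H b) (ε x) := by
  obtain rfl : a = b⁻¹ := eq_inv_of_mul_eq_one_left h
  have := LinearMap.congr_fun (antipode_left (k := k) (H := H) b)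
    (gcast k H (inv_mul_cancel b).symm x)
  refine this.trans ?_
  have key : ∀ (e : π) (h₁ : 1 = e) (h₂ : e = 1), gcast k H h₂ (gcast k H h₁ x) = x := by
    rintro e rfl _; rfl
  simp [key]

lemma antipodeTo_comulTo_right (h : b * a = 1) (h' : a * b = 1) (x : H 1) :
    LinearMap.mul' k (H a)
        (TensorProduct.map LinearMap.id (antipodeTo k H h) (comulTo k H h' x))
      = algebraMap k (H a) (ε x) := by
  obtain rfl : b = a⁻¹ := eq_inv_of_mul_eq_one_left h
  have := LinearMap.congr_fun (antipode_right (k := k) (H := H) a)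
    (gcast k H (mul_inv_cancel a).symm x)
  refine this.trans ?_
  have key : ∀ (e : π) (h₁ : 1 = e) (h₂ : e = 1), gcast k H h₂ (gcast k H h₁ x) = x := by
    rintro e rfl _; rfl
  simp [key]

/-- Right-invertible factors may be cancelled in convolution identities. -/
lemma conv_cancel {A : Type*} [Ring A] [Algebra k A] (h : a * b = 1) (h' : b * a = 1)
    {f f' g' : H a →ₗ[k] A} {g : H b →ₗ[k] A}
    (hg : ∀ x : H 1, LinearMap.mul' k A (TensorProduct.map g g' (comulTo k H h' x))
      = algebraMap k A (ε x))
    (hf : ∀ x : H 1, LinearMap.mul' k A (TensorProduct.map f g (comulTo k H h x))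
      = LinearMap.mul' k A (TensorProduct.map f' g (comulTo k H h x))) : f = f' := by
  have expand : ∀ (f : H a →ₗ[k] A) (x : H a), f x = LinearMap.mul' k A (TensorProduct.map
      (LinearMap.mul' k A ∘ₗ TensorProduct.map f g ∘ₗ (comulTo k H h).toLinearMap) g'
        (comulTo k H (one_mul a) x)) := by
    intro f x
    have assoc_mul : ∀ t : (H a ⊗[k] H b) ⊗[k] H a,
        LinearMap.mul' k A (TensorProduct.map (LinearMap.mul' k A ∘ₗ TensorProduct.map f g) g' t)
        = LinearMap.mul' k A (TensorProduct.map f (LinearMap.mul' k A ∘ₗ TensorProduct.map g g')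
            (TensorProduct.assoc k _ _ _ t)) := by
      intro t
      refine LinearMap.congr_fun (f := LinearMap.mul' k A ∘ₗ
        TensorProduct.map (LinearMap.mul' k A ∘ₗ TensorProduct.map f g) g')
        (g := LinearMap.mul' k A ∘ₗ (TensorProduct.map f
          (LinearMap.mul' k A ∘ₗ TensorProduct.map g g')) ∘ₗ
            (TensorProduct.assoc k _ _ _).toLinearMap) ?_ t
      ext p q r
      simp [mul_assoc]
    have h₁ := assoc_mul (TensorProduct.map (comulTo k H h).toLinearMap LinearMap.id
      (comulTo k H (one_mul a) x))
    rw [comulTo_coassoc k H h h' (one_mul a) (mul_one a)] at h₁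
    simp only [← LinearMap.comp_apply, ← TensorProduct.map_comp, LinearMap.comp_id] at h₁
    simp only [LinearMap.comp_apply] at h₁
    rw [← LinearMap.comp_assoc, h₁]
    have h₂ : (LinearMap.mul' k A ∘ₗ TensorProduct.map g g') ∘ₗ (comulTo k H h').toLinearMap
        = Algebra.linearMap k A ∘ₗ (ε (k := k) (H := H)).toLinearMap := LinearMap.ext hg
    rw [h₂]
    have h₃ : ∀ t : H a ⊗[k] H 1, LinearMap.mul' k A (TensorProduct.map f
        (Algebra.linearMap k A ∘ₗ (ε (k := k) (H := H)).toLinearMap) t)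
        = f (TensorProduct.rid k _ (TensorProduct.map LinearMap.id
          (ε (k := k) (H := H)).toLinearMap t)) := by
      intro t
      induction t with
      | zero => simp
      | add s t hs ht => simp only [map_add, hs, ht]
      | tmul p q => simp [← Algebra.commutes, ← Algebra.smul_def]
    rw [h₃, comulTo_counit_right]
  have hfg : LinearMap.mul' k A ∘ₗ TensorProduct.map f g ∘ₗ (comulTo k H h).toLinearMap
      = LinearMap.mul' k A ∘ₗ TensorProduct.map f' g ∘ₗ (comulTo k H h).toLinearMap :=
    LinearMap.ext hf
  ext x
  rw [expand f x, expand f' x, hfg]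

lemma antipodeTo_one (h : a * b = 1) : antipodeTo k H h 1 = 1 := by
  have := antipodeTo_comulTo_left k H h h 1
  simpa [Algebra.TensorProduct.one_def] using this

lemma antipodeTo_mul (h : a * b = 1) (x y : H a) :
    antipodeTo k H h (x * y) = antipodeTo k H h y * antipodeTo k H h x := by
  have h' : b * a = 1 := mul_eq_one_symm h
  have partialMul : ∀ (z : H 1) (y : H a), LinearMap.mul' k (H b) (TensorProduct.map
      (antipodeTo k H h ∘ₗ LinearMap.mulRight k y) LinearMap.id (comulTo k H h z))
      = algebraMap k (H b) (ε z) * antipodeTo k H h y := by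
    intro z
    suffices hh : LinearMap.mul' k (H b) ∘ₗ (TensorProduct.map (antipodeTo k H h) LinearMap.id) ∘ₗ
        LinearMap.mulLeft k (comulTo k H h z) ∘ₗ (TensorProduct.mk k (H a) (H b)).flip 1
        = LinearMap.mulLeft k (algebraMap k (H b) (ε z)) ∘ₗ antipodeTo k H h by
      intro y
      have := LinearMap.congr_fun hh y
      simp only [LinearMap.comp_apply, LinearMap.mulLeft_apply, LinearMap.flip_apply,
        TensorProduct.mk_apply] at this
      rw [← this]
      generalize comulTo k H h z = t
      induction t with
      | zero => simp
      | add s t hs ht => simp only [map_add, add_mul, hs, ht]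
      | tmul p q => simp
    refine conv_cancel k H h h' (g := LinearMap.id) (g' := antipodeTo k H h)
      (antipodeTo_comulTo_right k H h h') fun w => ?_
    have h₁ : ∀ s t : H a ⊗[k] H b, LinearMap.mul' k (H b) (TensorProduct.map
        (LinearMap.mul' k (H b) ∘ₗ (TensorProduct.map (antipodeTo k H h) LinearMap.id) ∘ₗ
        LinearMap.mulLeft k s ∘ₗ (TensorProduct.mk k (H a) (H b)).flip 1) LinearMap.id t)
        = LinearMap.mul' k (H b) (TensorProduct.map (antipodeTo k H h) LinearMap.id (s * t)) := by
      intro s t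
      induction t with
      | zero => simp
      | add t t' ht ht' => simp only [map_add, mul_add, ht, ht']
      | tmul p q =>
        induction s with
        | zero => simp
        | add s s' hs hs' =>
          simp only [TensorProduct.map_tmul, LinearMap.mul'_apply, LinearMap.comp_apply, map_add,
            LinearMap.mulLeft_apply, add_mul] at hs hs' ⊢
          rw [hs, hs']
        | tmul p' q' => simp [mul_assoc]
    have h₂ : ∀ t : H a ⊗[k] H b, LinearMap.mul' k (H b) (TensorProduct.map
        (LinearMap.mulLeft k (algebraMap k (H b) (ε z)) ∘ₗ antipodeTo k H h) LinearMap.id t)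
        = algebraMap k (H b) (ε z) *
          LinearMap.mul' k (H b) (TensorProduct.map (antipodeTo k H h) LinearMap.id t) := by
      intro t
      induction t with
      | zero => simp
      | add t t' ht ht' => simp only [map_add, mul_add, ht, ht']
      | tmul p q => simp [mul_assoc]
    rw [h₁, h₂, ← map_mul, antipodeTo_comulTo_left, antipodeTo_comulTo_left, map_mul, map_mul]
  suffices hh : antipodeTo k H h ∘ₗ LinearMap.mulRight k y
      = LinearMap.mulLeft k (antipodeTo k H h y) ∘ₗ antipodeTo k H h from
    LinearMap.congr_fun hh x
  refine conv_cancel k H h h' (g := LinearMap.id) (g' := antipodeTo k H h)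
    (antipodeTo_comulTo_right k H h h') fun z => ?_
  rw [partialMul]
  have h₂ : ∀ t : H a ⊗[k] H b, LinearMap.mul' k (H b) (TensorProduct.map
      (LinearMap.mulLeft k (antipodeTo k H h y) ∘ₗ antipodeTo k H h) LinearMap.id t)
      = antipodeTo k H h y *
        LinearMap.mul' k (H b) (TensorProduct.map (antipodeTo k H h) LinearMap.id t) := by
    intro t
    induction t with
    | zero => simp
    | add t t' ht ht' => simp only [map_add, mul_add, ht, ht']
    | tmul p q => simp [mul_assoc]
  rw [h₂, antipodeTo_comulTo_left, Algebra.commutes]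

end HopfGCoalgebra

namespace HopfGCoalgebra

variable (k : Type*) [Field k] {π : Type*} [Group π] (H : π → Type*)
  [∀ α, Ring (H α)] [∀ α, Algebra k (H α)] [HopfGCoalgebra k H] {a b c a' b' c' : π}

/-- The antipode reverses the comultiplication. -/
lemma comulTo_antipodeTo (h : a * b = c) (h' : b' * a' = c') (hc : c' * c = 1) (ha : a' * a = 1)
    (hb : b' * b = 1) (x : H c') :
    comulTo k H h (antipodeTo k H hc x)
      = TensorProduct.comm k _ _ (TensorProduct.map (antipodeTo k H hb) (antipodeTo k H ha)
          (comulTo k H h' x)) := by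
  have hc' : c * c' = 1 := mul_eq_one_symm hc
  suffices hh : (comulTo k H h).toLinearMap ∘ₗ antipodeTo k H hc
      = (TensorProduct.comm k _ _).toLinearMap ∘ₗ
        TensorProduct.map (antipodeTo k H hb) (antipodeTo k H ha) ∘ₗ
          (comulTo k H h').toLinearMap from LinearMap.congr_fun hh x
  refine conv_cancel k H hc hc' (g := (comulTo k H h).toLinearMap)
    (g' := (comulTo k H h).toLinearMap ∘ₗ antipodeTo k H hc) (fun z => ?_) fun z => ?_
  · have h₁ : ∀ t : H c ⊗[k] H c', LinearMap.mul' k _ (TensorProduct.map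
        (comulTo k H h).toLinearMap ((comulTo k H h).toLinearMap ∘ₗ antipodeTo k H hc) t)
        = comulTo k H h (LinearMap.mul' k _
          (TensorProduct.map LinearMap.id (antipodeTo k H hc) t)) := by
      intro t
      induction t with
      | zero => simp
      | add s t hs ht => simp only [map_add, hs, ht]
      | tmul p q => simp
    rw [h₁, antipodeTo_comulTo_right, AlgHom.commutes]
  · have h₁ : ∀ t : H c' ⊗[k] H c, LinearMap.mul' k _ (TensorProduct.map
        ((comulTo k H h).toLinearMap ∘ₗ antipodeTo k H hc) (comulTo k H h).toLinearMap t)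
        = comulTo k H h (LinearMap.mul' k _
          (TensorProduct.map (antipodeTo k H hc) LinearMap.id t)) := by
      intro t
      induction t with
      | zero => simp
      | add s t hs ht => simp only [map_add, hs, ht]
      | tmul p q => simp
    rw [h₁, antipodeTo_comulTo_left, AlgHom.commutes]
    have hac : a' * c = b := by rw [← h, ← mul_assoc, ha, one_mul]
    -- `contract (p ⊗ (q ⊗ t)) = (S q ⊗ S p) * t`
    let contract : H b' ⊗[k] (H a' ⊗[k] (H a ⊗[k] H b)) →ₗ[k] H a ⊗[k] H b :=
      LinearMap.mul' k _ ∘ₗ TensorProduct.map ((TensorProduct.comm k _ _).toLinearMap ∘ₗ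
        TensorProduct.map (antipodeTo k H hb) (antipodeTo k H ha)) LinearMap.id ∘ₗ
        (TensorProduct.assoc k _ _ _).symm.toLinearMap
    have contract_comul : ∀ (p : H b') (w : H b), contract (p ⊗ₜ TensorProduct.map LinearMap.id
        (comulTo k H h).toLinearMap (comulTo k H hac w)) = 1 ⊗ₜ (antipodeTo k H hb p * w) := by
      intro p w
      rw [← comulTo_coassoc k H ha h (one_mul b) hac]
      have h₂ : ∀ t : H 1 ⊗[k] H b, contract (p ⊗ₜ TensorProduct.assoc k _ _ _
          (TensorProduct.map (comulTo k H ha).toLinearMap LinearMap.id t))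
          = 1 ⊗ₜ (antipodeTo k H hb p * TensorProduct.lid k (H b)
            (TensorProduct.map (ε (k := k) (H := H)).toLinearMap LinearMap.id t)) := by
        intro t
        induction t with
        | zero => simp
        | add s t hs ht => simp only [map_add, mul_add, TensorProduct.tmul_add, hs, ht]
        | tmul y w =>
          have h₃ : ∀ s : H a' ⊗[k] H a, contract (p ⊗ₜ TensorProduct.assoc k _ _ _ (s ⊗ₜ w))
              = LinearMap.mul' k _ (TensorProduct.map (antipodeTo k H ha) LinearMap.id s) ⊗ₜ
                (antipodeTo k H hb p * w) := by
            intro s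
            induction s with
            | zero => simp
            | add s t hs ht =>
              simp only [map_add, TensorProduct.add_tmul, TensorProduct.tmul_add, hs, ht]
            | tmul q r => simp [contract]
          simp [h₃, antipodeTo_comulTo_left, Algebra.algebraMap_eq_smul_one,
            TensorProduct.smul_tmul]
      rw [h₂, comulTo_counit_left]
    have h₃ : ∀ t : H c' ⊗[k] H c, LinearMap.mul' k _ (TensorProduct.map
        ((TensorProduct.comm k _ _).toLinearMap ∘ₗ
        TensorProduct.map (antipodeTo k H hb) (antipodeTo k H ha) ∘ₗ
          (comulTo k H h').toLinearMap) (comulTo k H h).toLinearMap t)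
        = contract (TensorProduct.map LinearMap.id (TensorProduct.map LinearMap.id
              (comulTo k H h).toLinearMap) (TensorProduct.assoc k _ _ _
                (TensorProduct.map (comulTo k H h').toLinearMap LinearMap.id t))) := by
      intro t
      induction t with
      | zero => simp
      | add s t hs ht => simp only [map_add, hs, ht]
      | tmul y w =>
        simp only [TensorProduct.map_tmul, LinearMap.comp_apply, AlgHom.toLinearMap_apply,
          LinearMap.id_apply, LinearEquiv.coe_coe]
        generalize comulTo k H h' y = s
        induction s with
        | zero => simp
        | add s t hs ht =>
          simp only [map_add, TensorProduct.add_tmul, ← hs, ← ht]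
        | tmul p q => simp [contract]
    have h₄ : ∀ t : H b' ⊗[k] H b, contract (TensorProduct.map LinearMap.id
        (TensorProduct.map LinearMap.id (comulTo k H h).toLinearMap)
          (TensorProduct.map LinearMap.id (comulTo k H hac).toLinearMap t))
        = 1 ⊗ₜ LinearMap.mul' k _ (TensorProduct.map (antipodeTo k H hb) LinearMap.id t) := by
      intro t
      induction t with
      | zero => simp
      | add s t hs ht => simp only [map_add, TensorProduct.tmul_add, hs, ht]
      | tmul p w => simp [contract_comul]
    rw [h₃, comulTo_coassoc k H h' hac hc hb, h₄, antipodeTo_comulTo_left,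
      Algebra.algebraMap_eq_smul_one, Algebra.algebraMap_eq_smul_one, TensorProduct.tmul_smul]
    rfl

end HopfGCoalgebra

namespace CrossedHopfGCoalgebra

variable (k : Type*) [Field k] {π : Type*} [Group π] (H : π → Type*)
  [∀ α, Ring (H α)] [∀ α, Algebra k (H α)] [CrossedHopfGCoalgebra k H]

/-- The crossing `φ_β : H a → H b` for `β * a = b * β`. -/
def crossingTo (β : π) {a b : π} (h : β * a = b * β) : H a ≃ₐ[k] H b :=
  (φ β a).trans (gcast k H (mul_inv_eq_of_eq_mul h))

variable {a b c a' b' c' β γ δ : π}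

lemma crossingTo_comulTo (h : a * b = c) (h' : a' * b' = c') (ha : β * a = a' * β)
    (hb : β * b = b' * β) (hc : β * c = c' * β) (x : H c) :
    TensorProduct.map (crossingTo k H β ha).toLinearMap (crossingTo k H β hb).toLinearMap
        (comulTo k H h x) = comulTo k H h' (crossingTo k H β hc x) := by
  obtain rfl : a' = β * a * β⁻¹ := eq_mul_inv_of_mul_eq ha.symm
  obtain rfl : b' = β * b * β⁻¹ := eq_mul_inv_of_mul_eq hb.symm
  subst h h'
  exact LinearMap.congr_fun (φ_comul (k := k) (H := H) β a b) x

lemma counit_crossingTo (h : β * 1 = 1 * β) (x : H 1) :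
    ε (k := k) (H := H) (crossingTo k H β h x) = ε x := φ_counit β x

lemma crossingTo_crossingTo (h : β * a = b * β) (h' : γ * b = c * γ) (hδ : γ * β = δ)
    (h'' : δ * a = c * δ) (x : H a) :
    crossingTo k H γ h' (crossingTo k H β h x) = crossingTo k H δ h'' x := by
  obtain rfl : b = β * a * β⁻¹ := eq_mul_inv_of_mul_eq h.symm
  obtain rfl : c = γ * (β * a * β⁻¹) * γ⁻¹ := eq_mul_inv_of_mul_eq h'.symm
  subst hδ
  have key : ∀ (e : π) (h₁ : γ * β * a * (γ * β)⁻¹ = e) (h₂ : e = γ * β * a * (γ * β)⁻¹)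
      (y : H e), gcast k H h₁ (gcast k H h₂ y) = y := by
    rintro e rfl _ y; rfl
  have := φ_mul (k := k) (H := H) γ β a x
  simp only [crossingTo, AlgEquiv.trans_apply]
  rw [← this, key]
  rfl

lemma crossingTo_one (h : 1 * a = a * 1) (x : H a) : crossingTo k H 1 h x = x :=
  (crossingTo k H 1 h).injective (crossingTo_crossingTo k H h h (one_mul 1) h x)

/-- The antipode commutes with the crossing. -/
lemma crossingTo_antipodeTo (h : a * b = 1) (h' : a' * b' = 1) (ha : β * a = a' * β)
    (hb : β * b = b' * β) (x : H a) :
    crossingTo k H β hb (antipodeTo k H h x) = antipodeTo k H h' (crossingTo k H β ha x) := by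
  suffices hh : (crossingTo k H β hb).toLinearMap ∘ₗ antipodeTo k H h
      = antipodeTo k H h' ∘ₗ (crossingTo k H β ha).toLinearMap from LinearMap.congr_fun hh x
  have h₁ : β * 1 = 1 * β := by rw [mul_one, one_mul]
  refine conv_cancel k H h (mul_eq_one_symm h) (g := (crossingTo k H β hb).toLinearMap)
    (g' := (crossingTo k H β hb).toLinearMap ∘ₗ antipodeTo k H h) (fun z => ?_) fun z => ?_
  · have h₂ : ∀ t : H b ⊗[k] H a, LinearMap.mul' k _ (TensorProduct.map
        (crossingTo k H β hb).toLinearMap ((crossingTo k H β hb).toLinearMap ∘ₗ antipodeTo k H h) t)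
        = crossingTo k H β hb (LinearMap.mul' k _
          (TensorProduct.map LinearMap.id (antipodeTo k H h) t)) := by
      intro t
      induction t with
      | zero => simp
      | add s t hs ht => simp only [map_add, hs, ht]
      | tmul p q => simp
    rw [h₂, antipodeTo_comulTo_right, AlgEquiv.commutes]
  · have h₂ : ∀ t : H a ⊗[k] H b, LinearMap.mul' k _ (TensorProduct.map
        ((crossingTo k H β hb).toLinearMap ∘ₗ antipodeTo k H h) (crossingTo k H β hb).toLinearMap t)
        = crossingTo k H β hb (LinearMap.mul' k _
          (TensorProduct.map (antipodeTo k H h) LinearMap.id t)) := by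
      intro t
      induction t with
      | zero => simp
      | add s t hs ht => simp only [map_add, hs, ht]
      | tmul p q => simp
    rw [h₂, antipodeTo_comulTo_left, AlgEquiv.commutes]
    have h₃ : ∀ t : H a ⊗[k] H b, LinearMap.mul' k _ (TensorProduct.map
        (antipodeTo k H h' ∘ₗ (crossingTo k H β ha).toLinearMap)
          (crossingTo k H β hb).toLinearMap t)
        = LinearMap.mul' k _ (TensorProduct.map (antipodeTo k H h') LinearMap.id
          (TensorProduct.map (crossingTo k H β ha).toLinearMap
            (crossingTo k H β hb).toLinearMap t)) := by
      intro t
      induction t with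
      | zero => simp
      | add s t hs ht => simp only [map_add, hs, ht]
      | tmul p q => simp
    rw [h₃, crossingTo_comulTo k H h h' ha hb h₁, antipodeTo_comulTo_left, counit_crossingTo]

end CrossedHopfGCoalgebra

namespace QTHopfGCoalgebra

variable (k : Type*) [Field k] {π : Type*} [Group π] (H : π → Type*)
  [∀ α, Ring (H α)] [∀ α, Algebra k (H α)] [QTHopfGCoalgebra k H]
  {a b c d a' b' c' d' β : π}

lemma Rm_comulTo (h : a * b = c) (h' : b' * a = c) (hb : a⁻¹ * b' = b * a⁻¹) (x : H c) :
    Rm a b * comulTo k H h x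
      = TensorProduct.comm k _ _ (TensorProduct.map (crossingTo k H a⁻¹ hb).toLinearMap
          LinearMap.id (comulTo k H h' x)) * Rm a b := by
  obtain rfl : b' = a * b * a⁻¹ := by rw [h, ← h', mul_inv_cancel_right]
  subst h
  exact Rm_comul (k := k) (H := H) a b x

lemma Rm_comulTo_right (h : b * c = d) :
    TensorProduct.map LinearMap.id (comulTo k H h).toLinearMap (Rm a d)
      = TensorProduct.map LinearMap.id (TensorProduct.mk k (H b) (H c) 1) (Rm a c)
        * TensorProduct.map LinearMap.id ((TensorProduct.mk k (H b) (H c)).flip 1) (Rm a b) := by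
  subst h
  exact Rm_delta_right (k := k) (H := H) a b c

lemma Rm_comulTo_left (h : a * b = d) (hc : b⁻¹ * c' = c * b⁻¹) :
    TensorProduct.assoc k _ _ _
        (TensorProduct.map (comulTo k H h).toLinearMap LinearMap.id (Rm d c))
      = TensorProduct.map LinearMap.id (TensorProduct.mk k (H b) (H c) 1)
          (TensorProduct.map LinearMap.id (crossingTo k H b⁻¹ hc).toLinearMap (Rm a c'))
        * TensorProduct.mk k (H a) (H b ⊗[k] H c) 1 (Rm b c) := by
  obtain rfl : c' = b * c * b⁻¹ := by rw [mul_assoc, ← hc, mul_inv_cancel_left]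
  subst h
  exact Rm_delta_left (k := k) (H := H) a b c

lemma crossingTo_Rm (ha : β * a = a' * β) (hb : β * b = b' * β) :
    TensorProduct.map (crossingTo k H β ha).toLinearMap (crossingTo k H β hb).toLinearMap (Rm a b)
      = Rm a' b' := by
  obtain rfl : a' = β * a * β⁻¹ := eq_mul_inv_of_mul_eq ha.symm
  obtain rfl : b' = β * b * β⁻¹ := eq_mul_inv_of_mul_eq hb.symm
  exact Rm_phi (k := k) (H := H) β a b

/-- The twisted R-matrix `(id ⊗ φ_a)(R_{a, a⁻¹ba}) ∈ H a ⊗ H b`. -/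
def twistedR (a b : π) : H a ⊗[k] H b :=
  TensorProduct.map LinearMap.id
    (crossingTo k H a (show a * (a⁻¹ * b * a) = b * a by group)).toLinearMap (Rm a (a⁻¹ * b * a))

lemma twistedR_eq (h : a * b' = b * a) :
    twistedR k H a b
      = TensorProduct.map LinearMap.id (crossingTo k H a h).toLinearMap (Rm a b') := by
  obtain rfl : b' = a⁻¹ * b * a := by rw [mul_assoc, ← h, inv_mul_cancel_left]
  rfl

lemma twistedR_eq_left (h : a' * a = 1) (h' : a * a' = a' * a) :
    twistedR k H a' b
      = TensorProduct.map (crossingTo k H a h').toLinearMap LinearMap.id (Rm a' b) := by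
  obtain rfl : a' = a⁻¹ := eq_inv_of_mul_eq_one_left h
  rw [twistedR_eq k H (b' := a * b * a⁻¹) (by group),
    ← crossingTo_Rm k H (β := a) (a := a⁻¹) (b := b) h' (by group),
    ← LinearMap.comp_apply, ← TensorProduct.map_comp, LinearMap.id_comp]
  congr 2
  ext x
  simp only [LinearMap.comp_apply, AlgEquiv.toLinearMap_apply, LinearMap.id_apply]
  rw [crossingTo_crossingTo k H _ _ h (by simp), crossingTo_one]

lemma twistedR_comulTo (h : a * b' = b * a) (hc : a * b' = c) (hc' : b * a = c) (x : H c) :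
    twistedR k H a b * TensorProduct.map LinearMap.id (crossingTo k H a h).toLinearMap
        (comulTo k H hc x)
      = TensorProduct.comm k _ _ (comulTo k H hc' x) * twistedR k H a b := by
  have h₁ : a⁻¹ * b = b' * a⁻¹ := by rw [eq_mul_inv_iff_mul_eq, mul_assoc, ← h]; group
  rw [twistedR_eq k H h, ← tensorMap_mul _ _ (by simp) (by simp), Rm_comulTo k H hc hc' h₁,
    tensorMap_mul _ _ (by simp) (by simp)]
  congr 1
  generalize comulTo k H hc' x = t
  induction t with
  | zero => simp
  | add s t hs ht => simp only [map_add, hs, ht]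
  | tmul p q =>
    simp only [TensorProduct.map_tmul, TensorProduct.comm_tmul, AlgEquiv.toLinearMap_apply,
      LinearMap.id_apply]
    rw [crossingTo_crossingTo k H _ _ (mul_inv_cancel a) (by simp), crossingTo_one]

lemma Rm_comulTo_crossingTo (h : a * b = c) (h' : b * a = c') (hc : a * c' = c * a)
    (ha : a * a = a * a) (x : H c') :
    Rm a b * comulTo k H h (crossingTo k H a hc x)
      = TensorProduct.comm k _ _ (TensorProduct.map LinearMap.id
          (crossingTo k H a ha).toLinearMap (comulTo k H h' x)) * Rm a b := by
  have h₁ : a * b * a⁻¹ * a = c := by rw [inv_mul_cancel_right, h]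
  rw [Rm_comulTo k H h h₁ (by group), ← crossingTo_comulTo k H h' h₁ (by group) ha hc]
  congr 2
  rw [← LinearMap.comp_apply, ← TensorProduct.map_comp, LinearMap.id_comp]
  congr 2
  ext x
  simp only [LinearMap.comp_apply, AlgEquiv.toLinearMap_apply, LinearMap.id_apply]
  rw [crossingTo_crossingTo k H _ _ (inv_mul_cancel a) (by simp), crossingTo_one]

lemma twistedR_comulTo_right (h : b * c = d) :
    TensorProduct.map LinearMap.id (comulTo k H h).toLinearMap (twistedR k H a d)
      = TensorProduct.map LinearMap.id (TensorProduct.mk k (H b) (H c) 1) (twistedR k H a c)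
        * TensorProduct.map LinearMap.id ((TensorProduct.mk k (H b) (H c)).flip 1)
          (twistedR k H a b) := by
  have hb : a * (a⁻¹ * b * a) = b * a := by group
  have hc : a * (a⁻¹ * c * a) = c * a := by group
  have hd : a * (a⁻¹ * d * a) = d * a := by group
  have h' : (a⁻¹ * b * a) * (a⁻¹ * c * a) = a⁻¹ * d * a := by rw [← h]; group
  have h₁ : (comulTo k H h).toLinearMap ∘ₗ (crossingTo k H a hd).toLinearMap
      = TensorProduct.map (crossingTo k H a hb).toLinearMap (crossingTo k H a hc).toLinearMap ∘ₗ
        (comulTo k H h').toLinearMap :=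
    LinearMap.ext fun x => (crossingTo_comulTo k H h' h hb hc hd x).symm
  rw [twistedR_eq k H hd, twistedR_eq k H hb, twistedR_eq k H hc, ← LinearMap.comp_apply,
    ← TensorProduct.map_comp, h₁, TensorProduct.map_comp, LinearMap.comp_apply, Rm_comulTo_right,
    tensorMap_mul _ _ (by simp) (tensorMap_mul _ _ (by simp) (by simp))]
  simp only [← LinearMap.comp_apply, ← TensorProduct.map_comp, LinearMap.id_comp]
  congr 2 <;> (congr 1; ext x; simp)

lemma twistedR_comulTo_left (h : a * b = d) (hc : a * c' = c * a) :
    TensorProduct.assoc k _ _ _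
        (TensorProduct.map (comulTo k H h).toLinearMap LinearMap.id (twistedR k H d c))
      = TensorProduct.map LinearMap.id (TensorProduct.mk k (H b) (H c) 1) (twistedR k H a c)
        * TensorProduct.mk k (H a) (H b ⊗[k] H c) 1
          (TensorProduct.map LinearMap.id (crossingTo k H a hc).toLinearMap
            (twistedR k H b c')) := by
  have hd : d * (d⁻¹ * c * d) = c * d := by group
  have hb : b * (d⁻¹ * c * d) = c' * b := by
    rw [← h, mul_inv_rev]
    calc _ = a⁻¹ * (c * a) * b := by group
      _ = _ := by rw [← hc]; group
  have hb' : b⁻¹ * c' = d⁻¹ * c * d * b⁻¹ := by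
    rw [eq_mul_inv_iff_mul_eq, mul_assoc, ← hb]; group
  have h₁ : ∀ t : H d ⊗[k] H (d⁻¹ * c * d), TensorProduct.assoc k _ _ _
        (TensorProduct.map (comulTo k H h).toLinearMap LinearMap.id
          (TensorProduct.map LinearMap.id (crossingTo k H d hd).toLinearMap t))
      = TensorProduct.map LinearMap.id (TensorProduct.map LinearMap.id
          (crossingTo k H d hd).toLinearMap) (TensorProduct.assoc k _ _ _
        (TensorProduct.map (comulTo k H h).toLinearMap LinearMap.id t)) := by
    intro t
    induction t with
    | zero => simp
    | add s t hs ht => simp only [map_add, hs, ht]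
    | tmul x y =>
      simp only [TensorProduct.map_tmul, LinearMap.id_apply]
      generalize (comulTo k H h).toLinearMap x = s
      induction s with
      | zero => simp
      | add s t hs ht => simp only [map_add, TensorProduct.add_tmul, hs, ht]
      | tmul p q => simp
  rw [twistedR_eq k H hd, h₁, Rm_comulTo_left k H h hb',
    tensorMap_mul _ _ (by simp) (tensorMap_mul _ _ (by simp) (by simp)),
    twistedR_eq k H hc, twistedR_eq k H hb]
  congr 1
  · simp only [← LinearMap.comp_apply, ← TensorProduct.map_comp, LinearMap.id_comp]
    congr 2
    ext x
    simp only [LinearMap.comp_apply, AlgEquiv.toLinearMap_apply, LinearMap.id_apply,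
      TensorProduct.mk_apply, TensorProduct.map_tmul]
    rw [crossingTo_crossingTo k H _ _ (by rw [← h, mul_inv_cancel_right])]
  · simp only [TensorProduct.mk_apply, TensorProduct.map_tmul, LinearMap.id_apply,
      ← LinearMap.comp_apply, ← TensorProduct.map_comp, LinearMap.id_comp]
    congr 3
    ext x
    simp only [LinearMap.comp_apply, AlgEquiv.toLinearMap_apply]
    rw [crossingTo_crossingTo k H _ _ h]

lemma counit_Rm_left (c : π) (A : Type*) [Ring A] [Algebra k A] :
    TensorProduct.map (Algebra.linearMap k A ∘ₗ (ε (k := k) (H := H)).toLinearMap)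
      LinearMap.id (Rm 1 c : H 1 ⊗[k] H c) = 1 := by
  let counitOn (B : Type _) [Ring B] [Algebra k B] : H 1 ⊗[k] B →ₐ[k] B :=
    (Algebra.TensorProduct.lid k B).toAlgHom.comp (Algebra.TensorProduct.map ε (AlgHom.id k B))
  have h₀ := congrArg (counitOn (H 1 ⊗[k] H c))
    (Rm_comulTo_left k H (mul_one (1 : π)) (show (1 : π)⁻¹ * c = c * 1⁻¹ by simp))
  have h₁ : ∀ t : H 1 ⊗[k] H c, counitOn (H 1 ⊗[k] H c) (TensorProduct.assoc k _ _ _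
      (TensorProduct.map (comulTo k H (mul_one (1 : π))).toLinearMap LinearMap.id t)) = t := by
    intro t
    induction t with
    | zero => simp
    | add s t hs ht => simp only [map_add, hs, ht]
    | tmul x y =>
      have h₂ : ∀ s : H 1 ⊗[k] H 1, counitOn (H 1 ⊗[k] H c) (TensorProduct.assoc k _ _ _
          (s ⊗ₜ y)) = TensorProduct.lid k _ (TensorProduct.map (ε (k := k) (H := H)).toLinearMap
            LinearMap.id s) ⊗ₜ y := by
        intro s
        induction s with
        | zero => simp
        | add s t hs ht => simp only [map_add, TensorProduct.add_tmul, hs, ht]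
        | tmul p q =>
          simp [counitOn, TensorProduct.smul_tmul']
      simp only [TensorProduct.map_tmul, AlgHom.toLinearMap_apply, LinearMap.id_apply]
      rw [h₂, comulTo_counit_left]
  have h₂ : ∀ t : H 1 ⊗[k] H c, counitOn (H 1 ⊗[k] H c) (TensorProduct.map LinearMap.id
      (TensorProduct.mk k (H 1) (H c) 1) t) = 1 ⊗ₜ counitOn (H c) t := by
    intro t
    induction t with
    | zero => simp
    | add s t hs ht => simp only [map_add, TensorProduct.tmul_add, hs, ht]
    | tmul p q => simp [counitOn]
  have h₃ : (crossingTo k H (1 : π)⁻¹ (show (1 : π)⁻¹ * c = c * 1⁻¹ by simp)).toLinearMap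
      = LinearMap.id := by
    ext x
    simp only [AlgEquiv.toLinearMap_apply, LinearMap.id_apply]
    rw [← crossingTo_one k H (show (1 : π) * c = c * 1 by simp) x,
      crossingTo_crossingTo k H _ _ (δ := 1) (by simp) (by simp)]
  have h₄ : ∀ t : H 1 ⊗[k] H c,
      counitOn (H 1 ⊗[k] H c) (TensorProduct.mk k (H 1) (H 1 ⊗[k] H c) 1 t) = t := by
    intro t
    simp [counitOn]
  rw [h₁, map_mul, h₃, TensorProduct.map_id, LinearMap.id_apply, h₂, h₄] at h₀
  have h₅ : (1 : H 1) ⊗ₜ[k] counitOn (H c) (Rm 1 c) = 1 :=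
    (Rm_isUnit (k := k) (H := H) 1 c).mul_right_cancel (h₀.symm.trans (one_mul _).symm)
  have h₆ : counitOn (H c) (Rm 1 c) = 1 := by
    have := congrArg (counitOn (H c)) h₅
    simpa [counitOn] using this
  have h₇ : ∀ t : H 1 ⊗[k] H c, TensorProduct.map
      (Algebra.linearMap k A ∘ₗ (ε (k := k) (H := H)).toLinearMap) LinearMap.id t
      = 1 ⊗ₜ counitOn (H c) t := by
    intro t
    induction t with
    | zero => simp
    | add s t hs ht => simp only [map_add, TensorProduct.tmul_add, hs, ht]
    | tmul p q =>
      simp [counitOn, Algebra.algebraMap_eq_smul_one, TensorProduct.smul_tmul]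
  rw [h₇, h₆, Algebra.TensorProduct.one_def]

lemma counit_Rm_right (a : π) (A : Type*) [Ring A] [Algebra k A] :
    TensorProduct.map LinearMap.id (Algebra.linearMap k A ∘ₗ (ε (k := k) (H := H)).toLinearMap)
      (Rm a 1 : H a ⊗[k] H 1) = 1 := by
  -- evaluate the last tensor factor of `H a ⊗ (H 1 ⊗ H 1)` at the counit
  let counitOn : H 1 ⊗[k] H 1 →ₐ[k] H 1 :=
    (Algebra.TensorProduct.rid k k (H 1)).toAlgHom.comp
      (Algebra.TensorProduct.map (AlgHom.id k (H 1)) ε)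
  have h₀ := congrArg (TensorProduct.map (LinearMap.id : H a →ₗ[k] H a) counitOn.toLinearMap)
    (Rm_comulTo_right k H (a := a) (mul_one (1 : π)))
  have h₁ : counitOn.toLinearMap ∘ₗ (comulTo k H (mul_one (1 : π))).toLinearMap
      = LinearMap.id := by
    have h₂ : ∀ s : H 1 ⊗[k] H 1, counitOn s = TensorProduct.rid k _ (TensorProduct.map
        LinearMap.id (ε (k := k) (H := H)).toLinearMap s) := by
      intro s
      induction s with
      | zero => simp
      | add s t hs ht => simp only [map_add, hs, ht]
      | tmul p q => simp [counitOn]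
    ext x
    simp only [LinearMap.comp_apply, AlgHom.toLinearMap_apply, LinearMap.id_apply]
    rw [h₂, comulTo_counit_right]
  have h₂ : counitOn.toLinearMap ∘ₗ (TensorProduct.mk k (H 1) (H 1)).flip 1 = LinearMap.id := by
    ext x
    simp [counitOn]
  have h₃ : counitOn.toLinearMap ∘ₗ TensorProduct.mk k (H 1) (H 1) 1
      = Algebra.linearMap k (H 1) ∘ₗ (ε (k := k) (H := H)).toLinearMap := by
    ext x
    simp [counitOn, Algebra.algebraMap_eq_smul_one]
  rw [tensorMap_mul _ _ (by simp) (by simp)] at h₀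
  simp only [← LinearMap.comp_apply, ← TensorProduct.map_comp, LinearMap.id_comp, h₁, h₂, h₃,
    TensorProduct.map_id] at h₀
  have h₄ := (Rm_isUnit (k := k) (H := H) a 1).mul_right_cancel (h₀.symm.trans (one_mul _).symm)
  have h₅ := congrArg (TensorProduct.map (LinearMap.id : H a →ₗ[k] H a)
    (Algebra.linearMap k A ∘ₗ (ε (k := k) (H := H)).toLinearMap)) h₄
  rw [← LinearMap.comp_apply, ← TensorProduct.map_comp, LinearMap.id_comp] at h₅
  have h₆ : (Algebra.linearMap k A ∘ₗ (ε (k := k) (H := H)).toLinearMap) ∘ₗ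
      Algebra.linearMap k (H 1) ∘ₗ (ε (k := k) (H := H)).toLinearMap
      = Algebra.linearMap k A ∘ₗ (ε (k := k) (H := H)).toLinearMap := by
    ext x
    simp
  rw [h₆] at h₅
  rw [h₅]
  simp [Algebra.TensorProduct.one_def]

end QTHopfGCoalgebra

namespace QTHopfGCoalgebra

variable (k : Type*) [Field k] {π : Type*} [Group π] (H : π → Type*)
  [∀ α, Ring (H α)] [∀ α, Algebra k (H α)] [QTHopfGCoalgebra k H]
  {a b c d a' b' c' d' β γ : π}

lemma antipodeTo_twistedR_mul_Rm (ha : a * a' = 1) (c : π) :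
    TensorProduct.map (antipodeTo k H ha) LinearMap.id (twistedR k H a c) * Rm a' c = 1 := by
  obtain rfl : a = a'⁻¹ := eq_inv_of_mul_eq_one_left ha
  have hc : a'⁻¹ * (a' * c * a'⁻¹) = c * a'⁻¹ := by group
  have h₁ : ∀ t : H 1 ⊗[k] H c, TensorProduct.map (LinearMap.mul' k (H a') ∘ₗ
      TensorProduct.map (antipodeTo k H ha) LinearMap.id) LinearMap.id
      ((TensorProduct.assoc k _ _ _).symm (TensorProduct.assoc k _ _ _
        (TensorProduct.map (comulTo k H ha).toLinearMap LinearMap.id t)))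
      = TensorProduct.map (Algebra.linearMap k (H a') ∘ₗ (ε (k := k) (H := H)).toLinearMap)
        LinearMap.id t := by
    intro t
    rw [LinearEquiv.symm_apply_apply, ← LinearMap.comp_apply, ← TensorProduct.map_comp,
      LinearMap.id_comp]
    congr 2
    exact LinearMap.ext (antipodeTo_comulTo_left k H ha ha)
  have h₂ : ∀ (r : H a'⁻¹ ⊗[k] H c) (s : H a' ⊗[k] H c),
      TensorProduct.map (LinearMap.mul' k (H a') ∘ₗ
        TensorProduct.map (antipodeTo k H ha) LinearMap.id) LinearMap.id
        ((TensorProduct.assoc k _ _ _).symm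
          (TensorProduct.map LinearMap.id (TensorProduct.mk k (H a') (H c) 1) r
            * TensorProduct.mk k (H a'⁻¹) (H a' ⊗[k] H c) 1 s))
      = TensorProduct.map (antipodeTo k H ha) LinearMap.id r * s := by
    intro r s
    induction r with
    | zero => simp
    | add r r' hr hr' => simp only [map_add, add_mul, hr, hr']
    | tmul p q =>
      induction s with
      | zero => simp
      | add s s' hs hs' => simp only [map_add, mul_add, hs, hs']
      | tmul p' q' => simp
  rw [twistedR_eq k H hc, ← h₂, ← Rm_comulTo_left k H ha hc, h₁, counit_Rm_left]

lemma counit_twistedR_right (a : π) (A : Type*) [Ring A] [Algebra k A] :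
    TensorProduct.map LinearMap.id (Algebra.linearMap k A ∘ₗ (ε (k := k) (H := H)).toLinearMap)
      (twistedR k H a 1) = 1 := by
  rw [twistedR_eq k H (b' := 1) (by simp), ← LinearMap.comp_apply, ← TensorProduct.map_comp,
    LinearMap.id_comp, ← counit_Rm_right k H a A]
  congr 2
  ext x
  simp [counit_crossingTo]

lemma antipodeTo_twistedR_mul (ha : a * a' = 1) (hb : b' * b = 1) :
    TensorProduct.map (antipodeTo k H ha) LinearMap.id (twistedR k H a b)
      * TensorProduct.map (antipodeTo k H ha) (antipodeTo k H hb) (twistedR k H a b') = 1 := by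
  have hb' : b * b' = 1 := mul_eq_one_symm hb
  have h₁ : ∀ (r' : H a ⊗[k] H b') (r : H a ⊗[k] H b),
      TensorProduct.map (antipodeTo k H ha) (LinearMap.mul' k (H b) ∘ₗ
          TensorProduct.map LinearMap.id (antipodeTo k H hb))
        (TensorProduct.map LinearMap.id (TensorProduct.mk k (H b) (H b') 1) r'
          * TensorProduct.map LinearMap.id ((TensorProduct.mk k (H b) (H b')).flip 1) r)
      = TensorProduct.map (antipodeTo k H ha) LinearMap.id r
        * TensorProduct.map (antipodeTo k H ha) (antipodeTo k H hb) r' := by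
    intro r' r
    induction r with
    | zero => simp
    | add r s hr hs => simp only [map_add, add_mul, mul_add, hr, hs]
    | tmul p q =>
      induction r' with
      | zero => simp
      | add r s hr hs => simp only [map_add, add_mul, mul_add, hr, hs]
      | tmul p' q' => simp [antipodeTo_mul]
  rw [← h₁, ← twistedR_comulTo_right k H hb', ← LinearMap.comp_apply, ← TensorProduct.map_comp]
  have h₂ : (LinearMap.mul' k (H b) ∘ₗ TensorProduct.map LinearMap.id (antipodeTo k H hb)) ∘ₗ
      (comulTo k H hb').toLinearMap
      = Algebra.linearMap k (H b) ∘ₗ (ε (k := k) (H := H)).toLinearMap :=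
    LinearMap.ext (antipodeTo_comulTo_right k H hb hb')
  have h₃ := congrArg (TensorProduct.map (antipodeTo k H ha) (LinearMap.id : H b →ₗ[k] H b))
    (counit_twistedR_right k H a (H b))
  rw [← LinearMap.comp_apply, ← TensorProduct.map_comp, LinearMap.id_comp] at h₃
  rw [h₂, h₃, Algebra.TensorProduct.one_def, TensorProduct.map_tmul, antipodeTo_one,
    LinearMap.id_apply, Algebra.TensorProduct.one_def]

lemma Rm_mul_antipodeTo_twistedR (ha : a' * a = 1) (c : π) :
    Rm a c * TensorProduct.map (antipodeTo k H ha) LinearMap.id (twistedR k H a' c) = 1 := by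
  obtain ⟨v, hv⟩ := Rm_isUnit (k := k) (H := H) a c
  have h := antipodeTo_twistedR_mul_Rm k H ha c
  rw [← hv] at h ⊢
  rw [Units.mul_eq_one_iff_eq_inv.mp h, Units.mul_inv]

/-- The R-matrix is recovered by applying the antipode to both legs of the twisted R-matrix. -/
lemma antipodeTo_antipodeTo_twistedR (ha : a' * a = 1) (hc : c' * c = 1) :
    TensorProduct.map (antipodeTo k H ha) (antipodeTo k H hc) (twistedR k H a' c') = Rm a c := by
  have h := congrArg (Rm a c * ·) (antipodeTo_twistedR_mul k H ha hc)
  simpa only [← mul_assoc, Rm_mul_antipodeTo_twistedR, one_mul, mul_one] using h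

/-- The square of the antipode composed with the crossing by an element `β` commuting
with `a`. -/
def twistedSq (ha : a * a' = 1) (hβ : β * a' = a' * β) : H a →ₗ[k] H a :=
  antipodeTo k H (mul_eq_one_symm ha) ∘ₗ (crossingTo k H β hβ).toLinearMap ∘ₗ antipodeTo k H ha

lemma twistedSq_apply (ha : a * a' = 1) (ha' : a' * a = 1) (hβ : β * a' = a' * β) (x : H a) :
    twistedSq k H ha hβ x
      = antipodeTo k H ha' (crossingTo k H β hβ (antipodeTo k H ha x)) := rfl

lemma twistedSq_mul (ha : a * a' = 1) (hβ : β * a' = a' * β) (x y : H a) :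
    twistedSq k H ha hβ (x * y) = twistedSq k H ha hβ x * twistedSq k H ha hβ y := by
  simp [twistedSq, antipodeTo_mul]

lemma Rm_mul_twistedSq_twistedR (ha : a * a' = 1) (hβ : a * a' = a' * a) (hc : c' * c = 1) :
    Rm a c * TensorProduct.map (twistedSq k H ha hβ) (antipodeTo k H hc) (twistedR k H a c')
      = 1 := by
  have ha' := mul_eq_one_symm ha
  rw [← Rm_mul_antipodeTo_twistedR k H ha' c, twistedR_eq_left k H ha' hβ,
    ← antipodeTo_antipodeTo_twistedR k H ha hc, ← LinearMap.comp_apply, ← LinearMap.comp_apply,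
    ← TensorProduct.map_comp, ← TensorProduct.map_comp]
  rfl

/-- The map `p ⊗ q ↦ S(q) p` on `H a ⊗ H a'` for `a * a' = 1`. -/
def antipodeContract (ha : a' * a = 1) : H a ⊗[k] H a' →ₗ[k] H a :=
  LinearMap.mul' k (H a) ∘ₗ TensorProduct.map (antipodeTo k H ha) LinearMap.id ∘ₗ
    (TensorProduct.comm k (H a) (H a')).toLinearMap

@[simp]
lemma antipodeContract_tmul (ha : a' * a = 1) (p : H a) (q : H a') :
    antipodeContract k H ha (p ⊗ₜ q) = antipodeTo k H ha q * p := rfl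

lemma antipodeContract_mul_tmul (ha : a' * a = 1) (s : H a ⊗[k] H a') (p : H a) (q : H a') :
    antipodeContract k H ha (s * p ⊗ₜ q)
      = antipodeTo k H ha q * antipodeContract k H ha s * p := by
  induction s with
  | zero => simp
  | add s t hs ht => simp only [map_add, mul_add, add_mul, hs, ht]
  | tmul p' q' => simp [antipodeTo_mul, mul_assoc]

lemma drinfeld_eq (ha : a' * a = 1) :
    drinfeld k H a = antipodeContract k H ha (twistedR k H a a') := by
  obtain rfl : a' = a⁻¹ := eq_inv_of_mul_eq_one_left ha
  rw [twistedR_eq k H (b' := a⁻¹) (by simp), drinfeld]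
  generalize (Rm a a⁻¹ : H a ⊗[k] H a⁻¹) = t
  induction t with
  | zero => simp
  | add s t hs ht => simp only [map_add, hs, ht]
  | tmul p q => rfl

lemma sdrinfeld_eq (ha : a' * a = 1) :
    sdrinfeld k H a = antipodeTo k H ha (drinfeld k H a') := by
  obtain rfl : a' = a⁻¹ := eq_inv_of_mul_eq_one_left ha
  rfl

lemma antipodeSq_eq (ha : a * a' = 1) (ha' : a' * a = 1) (x : H a) :
    antipodeSq k H a x = antipodeTo k H ha' (antipodeTo k H ha x) := by
  obtain rfl : a' = a⁻¹ := eq_inv_of_mul_eq_one_left ha'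
  rfl

lemma antipodeTo_crossingTo_drinfeld (ha : a * a' = 1) (ha' : a' * a = 1)
    (hβ : a * a' = a' * a) (y : H 1) :
    LinearMap.mul' k (H a) (TensorProduct.map
      (LinearMap.mulRight k (drinfeld k H a) ∘ₗ antipodeTo k H ha' ∘ₗ
        (crossingTo k H a hβ).toLinearMap) LinearMap.id
        (TensorProduct.comm k _ _ (comulTo k H ha y)))
      = algebraMap k (H a) (ε y) * drinfeld k H a := by
  have h₁ : ∀ (s : H a ⊗[k] H a') (t : H a ⊗[k] H a'),
      antipodeContract k H ha' (s * TensorProduct.map LinearMap.id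
        (crossingTo k H a hβ).toLinearMap t)
      = LinearMap.mul' k (H a) (TensorProduct.map
        (LinearMap.mulRight k (antipodeContract k H ha' s) ∘ₗ antipodeTo k H ha' ∘ₗ
          (crossingTo k H a hβ).toLinearMap) LinearMap.id (TensorProduct.comm k _ _ t)) := by
    intro s t
    induction t with
    | zero => simp
    | add t t' ht ht' => simp only [map_add, mul_add, ht, ht']
    | tmul p q => simp [antipodeContract_mul_tmul]
  have h₂ : ∀ (t : H a' ⊗[k] H a) (p : H a) (q : H a'),
      antipodeContract k H ha' (TensorProduct.comm k _ _ t * p ⊗ₜ q)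
      = antipodeTo k H ha' q * LinearMap.mul' k (H a) (TensorProduct.map (antipodeTo k H ha')
        LinearMap.id t) * p := by
    intro t p q
    rw [antipodeContract_mul_tmul]
    congr 2
    induction t with
    | zero => simp
    | add s t hs ht => simp only [map_add, hs, ht]
    | tmul x y => simp
  have h₃ : ∀ s : H a ⊗[k] H a',
      antipodeContract k H ha' (TensorProduct.comm k _ _ (comulTo k H ha' y) * s)
      = algebraMap k (H a) (ε y) * antipodeContract k H ha' s := by
    intro s
    induction s with
    | zero => simp
    | add s t hs ht => simp only [map_add, mul_add, hs, ht]
    | tmul p q =>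
      rw [h₂, antipodeTo_comulTo_left, ← Algebra.commutes, mul_assoc, antipodeContract_tmul]
  rw [drinfeld_eq k H ha', ← h₁, ← h₃, twistedR_comulTo k H hβ ha ha']

/-- The Drinfeld element implements the twisted square of the antipode. -/
lemma drinfeld_mul (ha : a * a' = 1) (hβ : a * a' = a' * a) (x : H a) :
    drinfeld k H a * x = twistedSq k H ha hβ x * drinfeld k H a := by
  have ha' := mul_eq_one_symm ha
  let f : H a' →ₗ[k] H a := antipodeTo k H ha' ∘ₗ (crossingTo k H a hβ).toLinearMap
  let G : H a ⊗[k] H a' →ₗ[k] H a := LinearMap.mul' k (H a) ∘ₗ TensorProduct.map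
    (LinearMap.mulRight k (drinfeld k H a) ∘ₗ f) LinearMap.id ∘ₗ
      (TensorProduct.comm k _ _).toLinearMap
  let m : H a' ⊗[k] H a →ₗ[k] H a' :=
    LinearMap.mul' k (H a') ∘ₗ TensorProduct.map LinearMap.id (antipodeTo k H ha)
  let K : H a ⊗[k] (H a' ⊗[k] H a) →ₗ[k] H a := G ∘ₗ TensorProduct.map LinearMap.id m
  have h := congrArg K (comulTo_coassoc k H ha ha' (one_mul a) (mul_one a) x)
  have hf : ∀ c : k, f (algebraMap k _ c) = algebraMap k _ c := by
    intro c
    simp [f, Algebra.algebraMap_eq_smul_one, antipodeTo_one]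
  have h₁ : ∀ t : H 1 ⊗[k] H a, K (TensorProduct.assoc k _ _ _
      (TensorProduct.map (comulTo k H ha).toLinearMap LinearMap.id t))
      = twistedSq k H ha hβ (TensorProduct.lid k _ (TensorProduct.map
          (ε (k := k) (H := H)).toLinearMap LinearMap.id t)) * drinfeld k H a := by
    intro t
    induction t with
    | zero => simp
    | add s t hs ht => simp only [map_add, add_mul, hs, ht]
    | tmul y z =>
      have h₂ : ∀ s : H a ⊗[k] H a', K (TensorProduct.assoc k _ _ _ (s ⊗ₜ z))
          = twistedSq k H ha hβ z * G s := by
        intro s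
        induction s with
        | zero => simp
        | add s t hs ht => simp only [map_add, mul_add, TensorProduct.add_tmul, hs, ht]
        | tmul p q => simp [K, G, f, m, twistedSq, antipodeTo_mul, mul_assoc]
      have h₃ : G (comulTo k H ha y) = algebraMap k (H a) (ε y) * drinfeld k H a :=
        antipodeTo_crossingTo_drinfeld k H ha ha' hβ y
      simp only [TensorProduct.map_tmul, AlgHom.toLinearMap_apply, LinearMap.id_apply]
      rw [h₂, h₃, ← mul_assoc, ← Algebra.commutes, ← Algebra.smul_def]
      simp
  have h₂ : ∀ t : H a ⊗[k] H 1, K (TensorProduct.map LinearMap.id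
      (comulTo k H ha').toLinearMap t)
      = drinfeld k H a * TensorProduct.rid k _ (TensorProduct.map LinearMap.id
          (ε (k := k) (H := H)).toLinearMap t) := by
    intro t
    induction t with
    | zero => simp
    | add s t hs ht => simp only [map_add, mul_add, hs, ht]
    | tmul y z =>
      have h₃ : m (comulTo k H ha' z) = algebraMap k _ (ε z) :=
        antipodeTo_comulTo_right k H ha ha' z
      simp [K, G, h₃, hf, ← Algebra.smul_def]
  rw [h₁, h₂, comulTo_counit_left, comulTo_counit_right] at h
  exact h.symm

lemma isUnit_drinfeld (a : π) : IsUnit (drinfeld k H a) := by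
  have ha : a * a⁻¹ = 1 := mul_inv_cancel a
  have ha' : a⁻¹ * a = 1 := inv_mul_cancel a
  have hβ : a * a⁻¹ = a⁻¹ * a := ha.trans ha'.symm
  have h := congrArg (antipodeContract k H ha' ∘ₗ TensorProduct.map LinearMap.id
    (crossingTo k H a hβ).toLinearMap) (Rm_mul_twistedSq_twistedR k H ha hβ ha)
  have h₁ : ∀ (s t), antipodeContract k H ha' (s * TensorProduct.map LinearMap.id
      (crossingTo k H a hβ).toLinearMap
        (TensorProduct.map (twistedSq k H ha hβ) (antipodeTo k H ha) t))
      = LinearMap.mul' k _ (TensorProduct.map (twistedSq k H ha hβ ∘ₗ LinearMap.id)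
        (LinearMap.mulLeft k (antipodeContract k H ha' s) ∘ₗ twistedSq k H ha hβ)
          (TensorProduct.comm k _ _ t)) := by
    intro s t
    induction t with
    | zero => simp
    | add t t' ht ht' => simp only [map_add, mul_add, ht, ht']
    | tmul p q => simp [antipodeContract_mul_tmul, twistedSq, mul_assoc]
  have h₂ : ∀ t, LinearMap.mul' k _ (TensorProduct.map (twistedSq k H ha hβ ∘ₗ LinearMap.id)
        (LinearMap.mulLeft k (drinfeld k H a) ∘ₗ twistedSq k H ha hβ)
          (TensorProduct.comm k _ _ t))
      = drinfeld k H a * LinearMap.mul' k _ (TensorProduct.map LinearMap.id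
        (twistedSq k H ha hβ) (TensorProduct.comm k _ _ t)) := by
    intro t
    induction t with
    | zero => simp
    | add t t' ht ht' => simp only [map_add, mul_add, ht, ht']
    | tmul p q => simp [← mul_assoc, drinfeld_mul k H ha hβ q]
  rw [LinearMap.comp_apply, LinearMap.comp_apply,
    tensorMap_mul _ _ (by simp) (by simp), ← twistedR_eq k H hβ, h₁, ← drinfeld_eq k H ha', h₂]
    at h
  rw [Algebra.TensorProduct.one_def, TensorProduct.map_tmul, antipodeContract_tmul] at h
  simp only [LinearMap.id_apply, AlgEquiv.toLinearMap_apply, map_one, antipodeTo_one,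
    mul_one] at h
  have h' := h
  rw [drinfeld_mul k H ha hβ] at h'
  exact isUnit_iff_exists_and_exists.mpr ⟨⟨_, h⟩, ⟨_, h'⟩⟩

end QTHopfGCoalgebra

namespace QTHopfGCoalgebra

variable (k : Type*) [Field k] {π : Type*} [Group π] (H : π → Type*)
  [∀ α, Ring (H α)] [∀ α, Algebra k (H α)] [QTHopfGCoalgebra k H]
  {a b c d a' b' c' d' β γ : π}

lemma crossingTo_twistedR (ha : β * a = a * β) (hb : β * b = b * β) :
    TensorProduct.map (crossingTo k H β ha).toLinearMap (crossingTo k H β hb).toLinearMap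
      (twistedR k H a b) = twistedR k H a b := by
  have hb' : a * (a⁻¹ * b * a) = b * a := by group
  have hβ : β * (a⁻¹ * b * a) = (a⁻¹ * b * a) * β := by
    have h₁ : Commute β a := ha
    exact ((h₁.inv_right.mul_right hb).mul_right h₁).eq
  conv_rhs => rw [twistedR_eq k H hb', ← crossingTo_Rm k H ha hβ]
  rw [twistedR_eq k H hb']
  simp only [← LinearMap.comp_apply, ← TensorProduct.map_comp, LinearMap.id_comp,
    LinearMap.comp_id]
  congr 2
  ext x
  simp only [LinearMap.comp_apply, AlgEquiv.toLinearMap_apply]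
  rw [crossingTo_crossingTo k H _ _ ha 
    (by rw [mul_assoc, hβ, ← mul_assoc, hb', mul_assoc]), crossingTo_crossingTo k H _ _ rfl]

lemma crossingTo_drinfeld (h : β * a = a * β) :
    crossingTo k H β h (drinfeld k H a) = drinfeld k H a := by
  have ha : a * a⁻¹ = 1 := mul_inv_cancel a
  have ha' : a⁻¹ * a = 1 := inv_mul_cancel a
  have h' : β * a⁻¹ = a⁻¹ * β := (show Commute β a from h).inv_right.eq
  have h₁ : ∀ t, crossingTo k H β h (antipodeContract k H ha' t)
      = antipodeContract k H ha' (TensorProduct.map (crossingTo k H β h).toLinearMap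
        (crossingTo k H β h').toLinearMap t) := by
    intro t
    induction t with
    | zero => simp
    | add t t' ht ht' => simp only [map_add, ht, ht']
    | tmul p q => simp [crossingTo_antipodeTo k H ha' ha' h' h]
  rw [drinfeld_eq k H ha', h₁, crossingTo_twistedR]

/-- The map `p ⊗ q ↦ Δ(S(q)) (p ⊗ 1)`. -/
def comulContract (h : a * b = c) (hd : d * c = 1) : H a ⊗[k] H d →ₗ[k] H a ⊗[k] H b :=
  LinearMap.mul' k _ ∘ₗ TensorProduct.map ((comulTo k H h).toLinearMap ∘ₗ antipodeTo k H hd)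
    ((TensorProduct.mk k (H a) (H b)).flip 1) ∘ₗ (TensorProduct.comm k (H a) (H d)).toLinearMap

@[simp]
lemma comulContract_tmul (h : a * b = c) (hd : d * c = 1) (p : H a) (q : H d) :
    comulContract k H h hd (p ⊗ₜ q) = comulTo k H h (antipodeTo k H hd q) * p ⊗ₜ 1 := rfl

lemma Rm_mul_comulContract (h : a * b = c) (hd : d * c = 1) :
    Rm a b * comulContract k H h hd (twistedR k H a d) = drinfeld k H a ⊗ₜ 1 := by
  have ha : a * a⁻¹ = 1 := mul_inv_cancel a
  have ha' : a⁻¹ * a = 1 := inv_mul_cancel a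
  have hb' : b⁻¹ * b = 1 := inv_mul_cancel b
  have hβ : a * a⁻¹ = a⁻¹ * a := ha.trans ha'.symm
  have h' : b⁻¹ * a⁻¹ = d := by rw [eq_inv_of_mul_eq_one_left hd, ← h, mul_inv_rev]
  let V : H a ⊗[k] (H b⁻¹ ⊗[k] H a⁻¹) →ₗ[k] H a ⊗[k] H b :=
    LinearMap.mul' k _ ∘ₗ TensorProduct.map ((TensorProduct.comm k _ _).toLinearMap ∘ₗ
      TensorProduct.map (antipodeTo k H hb') (antipodeTo k H ha'))
        ((TensorProduct.mk k (H a) (H b)).flip 1) ∘ₗ (TensorProduct.comm k _ _).toLinearMap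
  have h₁ : ∀ t, comulContract k H h hd t
      = V (TensorProduct.map LinearMap.id (comulTo k H h').toLinearMap t) := by
    intro t
    induction t with
    | zero => simp
    | add t t' ht ht' => simp only [map_add, ht, ht']
    | tmul p q => simp [V, comulTo_antipodeTo k H h h' hd ha' hb']
  have h₂ : ∀ s r, V (TensorProduct.map LinearMap.id (TensorProduct.mk k (H b⁻¹) (H a⁻¹) 1) s
        * TensorProduct.map LinearMap.id ((TensorProduct.mk k (H b⁻¹) (H a⁻¹)).flip 1) r)
      = antipodeContract k H ha' s ⊗ₜ 1
        * TensorProduct.map LinearMap.id (antipodeTo k H hb') r := by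
    intro s r
    induction s with
    | zero => simp
    | add t t' ht ht' => simp only [map_add, add_mul, TensorProduct.add_tmul, ht, ht']
    | tmul p q =>
      induction r with
      | zero => simp
      | add t t' ht ht' => simp only [map_add, mul_add, ht, ht']
      | tmul p' q' => simp [V, mul_assoc]
  have h₃ : ∀ r : H a ⊗[k] H b⁻¹, (drinfeld k H a ⊗ₜ[k] (1 : H b))
        * TensorProduct.map LinearMap.id (antipodeTo k H hb') r
      = TensorProduct.map (twistedSq k H ha hβ) (antipodeTo k H hb') r
        * (drinfeld k H a ⊗ₜ[k] (1 : H b)) := by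
    intro r
    induction r with
    | zero => simp
    | add t t' ht ht' => simp only [map_add, mul_add, add_mul, ht, ht']
    | tmul p q => simp [drinfeld_mul k H ha hβ]
  rw [h₁, twistedR_comulTo_right k H h', h₂, ← drinfeld_eq, h₃, ← mul_assoc,
    Rm_mul_twistedSq_twistedR k H ha hβ hb', one_mul]

/-- The monodromy `σ((id ⊗ φ_a)(R_{b,a})) R_{a,b}`. -/
def monodromy (a b : π) : H a ⊗[k] H b :=
  TensorProduct.comm k _ _ (TensorProduct.map LinearMap.id
    (crossingTo k H a (rfl : a * a = a * a)).toLinearMap (Rm b a)) * Rm a b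

lemma monodromy_mul_comulTo_drinfeld (h : a * b = c) :
    monodromy k H a b * comulTo k H h (drinfeld k H c) = drinfeld k H a ⊗ₜ drinfeld k H b := by
  have hd : c⁻¹ * c = 1 := inv_mul_cancel c
  have hd' : (b * a)⁻¹ * (b * a) = 1 := inv_mul_cancel _
  have hφ : a * (b * a)⁻¹ = c⁻¹ * a := by rw [← h]; group
  have hφ' : a * (b * a) = c * a := by rw [← h]; group
  let W : H a ⊗[k] (H b ⊗[k] H c⁻¹) →ₗ[k] H a ⊗[k] H b :=
    LinearMap.mul' k _ ∘ₗ TensorProduct.map ((comulTo k H h).toLinearMap ∘ₗ antipodeTo k H hd)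
      LinearMap.id ∘ₗ (TensorProduct.comm k _ _).toLinearMap ∘ₗ
        (TensorProduct.assoc k _ _ _).symm.toLinearMap
  have h₁ : ∀ t, comulTo k H h (antipodeContract k H hd t) = W (TensorProduct.assoc k _ _ _
        (TensorProduct.map (comulTo k H h).toLinearMap LinearMap.id t)) := by
    intro t
    induction t with
    | zero => simp
    | add t t' ht ht' => simp only [map_add, ht, ht']
    | tmul p q => simp [W]
  have h₂ : ∀ s p q, W (TensorProduct.map LinearMap.id (TensorProduct.mk k (H b) (H c⁻¹) 1) s
        * 1 ⊗ₜ (p ⊗ₜ q))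
      = comulTo k H h (antipodeTo k H hd q) * comulContract k H h hd s * 1 ⊗ₜ p := by
    intro s p q
    induction s with
    | zero => simp
    | add t t' ht ht' => simp only [map_add, mul_add, add_mul, ht, ht']
    | tmul p' q' => simp [W, antipodeTo_mul, mul_assoc]
  have h₃ : ∀ t, Rm a b * W (TensorProduct.map LinearMap.id
        (TensorProduct.mk k (H b) (H c⁻¹) 1) (twistedR k H a c⁻¹)
        * TensorProduct.mk k (H a) (H b ⊗[k] H c⁻¹) 1
          (TensorProduct.map LinearMap.id (crossingTo k H a hφ).toLinearMap t))
      = TensorProduct.comm k _ _ (TensorProduct.map LinearMap.id (crossingTo k H a rfl).toLinearMap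
        (comulContract k H rfl hd' t)) * drinfeld k H a ⊗ₜ 1 := by
    intro t
    induction t with
    | zero => simp
    | add t t' ht ht' => simp only [map_add, mul_add, add_mul, ht, ht']
    | tmul p q =>
      rw [TensorProduct.map_tmul, LinearMap.id_apply, TensorProduct.mk_apply, h₂,
        AlgEquiv.toLinearMap_apply, ← crossingTo_antipodeTo k H hd' hd hφ hφ', ← mul_assoc,
        ← mul_assoc, Rm_comulTo_crossingTo k H h rfl hφ' rfl, mul_assoc _ (Rm a b),
        Rm_mul_comulContract, comulContract_tmul, tensorMap_mul _ _ (by simp) (by simp),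
        tensorComm_mul, mul_assoc, mul_assoc]
      simp
  have h₄ := Rm_mul_comulContract k H (rfl : b * a = b * a) hd'
  rw [drinfeld_eq k H hd, h₁, twistedR_comulTo_left k H h hφ, monodromy, mul_assoc, h₃,
    ← mul_assoc, ← tensorComm_mul, ← tensorMap_mul _ _ (by simp) (by simp), h₄]
  simp

lemma twistedSq_eq (ha : a * a' = 1) (hβ : β * a' = a' * β) (hβ' : β * a = a * β) (x : H a) :
    twistedSq k H ha hβ x = antipodeSq k H a (crossingTo k H β hβ' x) := by
  rw [antipodeSq_eq k H ha (mul_eq_one_symm ha), ← crossingTo_antipodeTo k H ha ha hβ' hβ]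
  rfl

lemma crossingTo_antipodeSq (hβ : β * a = a * β) (x : H a) :
    crossingTo k H β hβ (antipodeSq k H a x) = antipodeSq k H a (crossingTo k H β hβ x) := by
  have ha : a * a⁻¹ = 1 := mul_inv_cancel a
  have ha' : a⁻¹ * a = 1 := inv_mul_cancel a
  have hβ' : β * a⁻¹ = a⁻¹ * β := (show Commute β a from hβ).inv_right.eq
  rw [antipodeSq_eq k H ha ha', antipodeSq_eq k H ha ha',
    crossingTo_antipodeTo k H ha' ha' hβ' hβ, crossingTo_antipodeTo k H ha ha hβ hβ']

lemma antipodeTo_surjective (ha : a' * a = 1) : Function.Surjective (antipodeTo k H ha) := by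
  intro x
  have ha' := mul_eq_one_symm ha
  have hβ : a * a' = a' * a := ha'.trans ha.symm
  obtain ⟨u, hu⟩ := isUnit_drinfeld k H a
  have h := drinfeld_mul k H ha' hβ (↑u⁻¹ * x * u)
  rw [← hu, mul_assoc, Units.mul_inv_cancel_left, Units.mul_left_inj] at h
  exact ⟨_, h.symm⟩

lemma isUnit_sdrinfeld (a : π) : IsUnit (sdrinfeld k H a) := by
  rw [sdrinfeld_eq k H (inv_mul_cancel a)]
  obtain ⟨u, hu⟩ := isUnit_drinfeld k H a⁻¹
  rw [← hu]
  refine isUnit_iff_exists_and_exists.mpr ⟨⟨antipodeTo k H (inv_mul_cancel a) ↑u⁻¹, ?_⟩,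
    ⟨antipodeTo k H (inv_mul_cancel a) ↑u⁻¹, ?_⟩⟩ <;>
  simp [← antipodeTo_mul, antipodeTo_one]

lemma sdrinfeld_mul_twistedSq (ha : a * a' = 1) (x : H a) :
    sdrinfeld k H a * twistedSq k H ha (rfl : a' * a' = a' * a') x = x * sdrinfeld k H a := by
  have ha' := mul_eq_one_symm ha
  obtain ⟨y, rfl⟩ := antipodeTo_surjective k H ha' x
  have hβ : a' * a = a * a' := ha'.trans ha.symm
  have h := congrArg (antipodeTo k H ha') (drinfeld_mul k H ha' hβ y)
  rw [antipodeTo_mul, antipodeTo_mul, ← sdrinfeld_eq] at h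
  rw [h, twistedSq_apply k H ha ha', twistedSq_apply k H ha' ha,
    crossingTo_antipodeTo k H ha ha hβ]

lemma crossingTo_antipodeTo_Rm (ha : a * a' = 1) (hb : b * b' = 1) :
    TensorProduct.map ((crossingTo k H a' (rfl : a' * a' = a' * a')).toLinearMap ∘ₗ
      antipodeTo k H ha) (antipodeTo k H hb) (Rm a b) = Rm a' b' := by
  have hβ : a' * a = a * a' := (mul_eq_one_symm ha).trans ha.symm
  rw [← antipodeTo_antipodeTo_twistedR k H ha hb, twistedR_eq_left k H ha hβ,
    ← LinearMap.comp_apply, ← TensorProduct.map_comp, LinearMap.comp_id]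
  congr 2
  ext x
  exact crossingTo_antipodeTo k H ha ha hβ rfl x

lemma twistedSq_monodromy (ha : a * a' = 1) (ha' : a' * a = 1) (hb : b * b' = 1)
    (hb' : b' * b = 1) :
    TensorProduct.map (twistedSq k H ha (rfl : a' * a' = a' * a'))
        (twistedSq k H hb (rfl : b' * b' = b' * b')) (monodromy k H a b)
      = TensorProduct.comm k _ _ (TensorProduct.map (antipodeTo k H hb') (antipodeTo k H ha')
        (monodromy k H b' a')) := by
  have hβ : a' * a = a * a' := ha'.trans ha.symm
  rw [monodromy, monodromy, tensorMap_mul _ _ (twistedSq_mul k H _ _) (twistedSq_mul k H _ _),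
    tensorMap_antimul _ _ (antipodeTo_mul k H _) (antipodeTo_mul k H _), tensorComm_mul,
    ← crossingTo_antipodeTo_Rm k H ha hb, ← crossingTo_antipodeTo_Rm k H hb ha]
  congr 1
  · generalize (Rm b a : H b ⊗[k] H a) = t
    induction t with
    | zero => simp
    | add t t' ht ht' => simp only [map_add, ht, ht']
    | tmul p q =>
      simp only [TensorProduct.map_tmul, TensorProduct.comm_tmul, LinearMap.comp_apply,
        LinearMap.id_apply, AlgEquiv.toLinearMap_apply]
      rw [twistedSq_apply k H hb hb', twistedSq_apply k H ha ha',
        ← crossingTo_antipodeTo k H ha ha rfl hβ.symm, crossingTo_crossingTo k H _ _ ha' (by simp),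
        crossingTo_one]
  · generalize (Rm a b : H a ⊗[k] H b) = t
    induction t with
    | zero => simp
    | add t t' ht ht' => simp only [map_add, ht, ht']
    | tmul p q => rfl

lemma isUnit_tmul {A B : Type*} [Ring A] [Ring B] [Algebra k A] [Algebra k B] {x : A} {y : B}
    (hx : IsUnit x) (hy : IsUnit y) : IsUnit (x ⊗ₜ[k] y) := by
  have h := (hx.map (Algebra.TensorProduct.includeLeft : A →ₐ[k] A ⊗[k] B)).mul
    (hy.map (Algebra.TensorProduct.includeRight : B →ₐ[k] A ⊗[k] B))
  simpa using h

lemma monodromy_mul_comulTo_sdrinfeld (h : a * b = c) :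
    monodromy k H a b * comulTo k H h (sdrinfeld k H c) = sdrinfeld k H a ⊗ₜ sdrinfeld k H b := by
  have ha : a * a⁻¹ = 1 := mul_inv_cancel a
  have ha' : a⁻¹ * a = 1 := inv_mul_cancel a
  have hb : b * b⁻¹ = 1 := mul_inv_cancel b
  have hb' : b⁻¹ * b = 1 := inv_mul_cancel b
  have hc' : c⁻¹ * c = 1 := inv_mul_cancel c
  have h' : b⁻¹ * a⁻¹ = c⁻¹ := by rw [← h, mul_inv_rev]
  have h₁ := congrArg (fun t => TensorProduct.comm k _ _ (TensorProduct.map (antipodeTo k H hb')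
    (antipodeTo k H ha') t)) (monodromy_mul_comulTo_drinfeld k H h')
  simp only [tensorMap_antimul _ _ (antipodeTo_mul k H _) (antipodeTo_mul k H _), tensorComm_mul,
    ← comulTo_antipodeTo k H h h' hc' ha' hb', TensorProduct.map_tmul, TensorProduct.comm_tmul,
    ← sdrinfeld_eq, ← twistedSq_monodromy k H ha ha' hb hb'] at h₁
  have h₂ : ∀ t, (sdrinfeld k H a ⊗ₜ[k] sdrinfeld k H b) * TensorProduct.map
      (twistedSq k H ha (rfl : a⁻¹ * a⁻¹ = a⁻¹ * a⁻¹))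
        (twistedSq k H hb (rfl : b⁻¹ * b⁻¹ = b⁻¹ * b⁻¹)) t
      = t * (sdrinfeld k H a ⊗ₜ[k] sdrinfeld k H b) := by
    intro t
    induction t with
    | zero => simp
    | add t t' ht ht' => simp only [map_add, mul_add, add_mul, ht, ht']
    | tmul p q => simp [sdrinfeld_mul_twistedSq]
  have h₃ := h₂ (monodromy k H a b)
  nth_rewrite 2 [← h₁] at h₃
  rw [← mul_assoc] at h₃
  have hu : IsUnit (comulTo k H h (sdrinfeld k H c)) := (isUnit_sdrinfeld k H c).map _
  refine (IsUnit.mul_right_cancel ?_ h₃).symm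
  rw [← hu.mul_left_iff, h₁]
  exact isUnit_tmul k (isUnit_sdrinfeld k H a) (isUnit_sdrinfeld k H b)

lemma sdrinfeld_mul_ell (a : π) : sdrinfeld k H a * ell k H a = drinfeld k H a :=
  Ring.mul_inverse_cancel_left _ _ (isUnit_sdrinfeld k H a)

lemma isUnit_ell (a : π) : IsUnit (ell k H a) := by
  rw [← (isUnit_sdrinfeld k H a).mul_left_iff, sdrinfeld_mul_ell]
  exact isUnit_drinfeld k H a

lemma comulTo_ell (h : a * b = c) : comulTo k H h (ell k H c) = ell k H a ⊗ₜ ell k H b := by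
  refine (isUnit_tmul k (isUnit_sdrinfeld k H a) (isUnit_sdrinfeld k H b)).mul_left_cancel ?_
  rw [Algebra.TensorProduct.tmul_mul_tmul, sdrinfeld_mul_ell, sdrinfeld_mul_ell,
    ← monodromy_mul_comulTo_sdrinfeld k H h, mul_assoc, ← map_mul, sdrinfeld_mul_ell,
    monodromy_mul_comulTo_drinfeld]

lemma isGrouplike_ell : IsGrouplike k H (fun α => ell k H α) := by
  refine ⟨fun α β => comulTo_ell k H rfl, ?_⟩
  have h := congrArg (ε (k := k) (H := H)) (comulTo_counit_left k H (one_mul 1) (ell k H 1))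
  rw [comulTo_ell] at h
  simp only [TensorProduct.map_tmul, TensorProduct.lid_tmul, AlgHom.toLinearMap_apply,
    LinearMap.id_apply, map_smul, smul_eq_mul] at h
  have hu : IsUnit (ε (k := k) (H := H) (ell k H 1)) := (isUnit_ell k H 1).map _
  exact hu.mul_left_cancel (h.trans (mul_one _).symm)

lemma commute_sdrinfeld_drinfeld (a : π) : Commute (sdrinfeld k H a) (drinfeld k H a) := by
  have ha : a * a⁻¹ = 1 := mul_inv_cancel a
  have hβ : a * a⁻¹ = a⁻¹ * a := by simp
  have h₁ := (isUnit_drinfeld k H a).mul_right_cancel (drinfeld_mul k H ha hβ (drinfeld k H a))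
  have h₂ := sdrinfeld_mul_twistedSq k H ha (drinfeld k H a)
  rw [twistedSq_eq k H ha hβ rfl, crossingTo_drinfeld] at h₁
  rwa [twistedSq_eq k H ha rfl hβ.symm, crossingTo_drinfeld, ← h₁] at h₂

lemma inverse_sdrinfeld_mul_drinfeld (a : π) :
    Ring.inverse (sdrinfeld k H a) * drinfeld k H a
      = drinfeld k H a * Ring.inverse (sdrinfeld k H a) := by
  rw [Ring.inverse_mul_eq_iff_eq_mul _ _ _ (isUnit_sdrinfeld k H a), ← mul_assoc,
    (commute_sdrinfeld_drinfeld k H a).eq,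
    Ring.mul_inverse_cancel_right _ _ (isUnit_sdrinfeld k H a)]

lemma antipodeSq_antipodeSq_mul_ell (a : π) (x : H a) :
    antipodeSq k H a (antipodeSq k H a x) * ell k H a = ell k H a * x := by
  have ha : a * a⁻¹ = 1 := mul_inv_cancel a
  have hβ : a * a⁻¹ = a⁻¹ * a := by simp
  have h₁ : antipodeSq k H a (antipodeSq k H a x)
      = twistedSq k H ha hβ (twistedSq k H ha rfl x) := by
    rw [twistedSq_eq k H ha hβ rfl, twistedSq_eq k H ha rfl hβ.symm, crossingTo_antipodeSq,
      crossingTo_crossingTo k H _ _ ha (by simp), crossingTo_one]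
  have h₂ : twistedSq k H ha rfl x * Ring.inverse (sdrinfeld k H a)
      = Ring.inverse (sdrinfeld k H a) * x := by
    refine (isUnit_sdrinfeld k H a).mul_left_cancel ?_
    rw [← mul_assoc, sdrinfeld_mul_twistedSq,
      Ring.mul_inverse_cancel_right _ _ (isUnit_sdrinfeld k H a),
      Ring.mul_inverse_cancel_left _ _ (isUnit_sdrinfeld k H a)]
  rw [h₁, ell, inverse_sdrinfeld_mul_drinfeld, ← mul_assoc, ← drinfeld_mul, mul_assoc, h₂,
    mul_assoc]

end QTHopfGCoalgebra

/-- Corollary 6.5: the family `ℓ_α = S_{α⁻¹}(u_{α⁻¹})⁻¹ u_α` is a `π`-grouplike element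
implementing the square of `S_{α⁻¹} ∘ S_α` by conjugation. -/
theorem ell_grouplike_and_conjugation (k : Type*) [Field k] {π : Type*} [Group π]
    (H : π → Type*) [∀ α, Ring (H α)] [∀ α, Algebra k (H α)] [QTHopfGCoalgebra k H] :
    -- `u_α` and `S_{α⁻¹}(u_{α⁻¹})` are invertible, and
    -- `S_{α⁻¹}(u_{α⁻¹})⁻¹ u_α = u_α S_{α⁻¹}(u_{α⁻¹})⁻¹`
    (∀ α : π, IsUnit (drinfeld k H α) ∧ IsUnit (sdrinfeld k H α) ∧
      Ring.inverse (sdrinfeld k H α) * drinfeld k H α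
        = drinfeld k H α * Ring.inverse (sdrinfeld k H α)) ∧
    -- (a) `ℓ` is `π`-grouplike
    IsGrouplike k H (fun α => ell k H α) ∧
    -- (b) `(S_{α⁻¹} ∘ S_α)² (x) = ℓ_α x ℓ_α⁻¹`
    (∀ (α : π) (x : H α),
      antipodeSq k H α (antipodeSq k H α x)
        = ell k H α * x * Ring.inverse (ell k H α)) := by
  refine ⟨fun α => ⟨isUnit_drinfeld k H α, isUnit_sdrinfeld k H α,
    inverse_sdrinfeld_mul_drinfeld k H α⟩, isGrouplike_ell k H, fun α x => ?_⟩
  rw [← antipodeSq_antipodeSq_mul_ell, Ring.mul_inverse_cancel_right _ _ (isUnit_ell k H α)]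
end
end
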